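/- Let Δ = (T, 𝒮, ℬ) be a strong triangle blocking arrangement with vertices x₁, x₂, x₃ of T. Suppose some blocking segment passes through x₁ and some blocking segment passes through x₂. Suppose a₁a₂, b₁b₂ ∈ 𝒮 are proper initial segments with a₁ ∈ x₁x₂, b₂ ∈ x₂x₃ and a₂, b₁ ∈ x₁x₃. Then a₁a₂ and b₁b₂ are disjoint. -/

import Mathlib

open Set

noncomputable section

/-- Points of the real plane. -/
abbrev Pt := ℝ × ℝ

/-- The boundary of the triangle with vertices `x1`, `x2`, `x3`:
the union of its three edges. -/
def triBdry (x1 x2 x3 : Pt) : Set Pt :=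
  segment ℝ x1 x2 ∪ segment ℝ x2 x3 ∪ segment ℝ x3 x1

/-- The three edges of the triangle with vertices `x1`, `x2`, `x3`. -/
def triEdges (x1 x2 x3 : Pt) : Set (Set Pt) :=
  {segment ℝ x1 x2, segment ℝ x2 x3, segment ℝ x3 x1}

/-- A triangle blocking arrangement: a nondegenerate triangle `x1 x2 x3` together with two
finite collections `S` (proper initial segments) and `B` (blocking segments) of closed
segments with endpoints on the boundary of the triangle and no interior point on the
boundary, satisfying the intersection conditions (i) and (ii). `S ∪ triEdges x1 x2 x3`
is the collection of initial segments `𝒮̄`. -/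
structure TBA where
  x1 : Pt
  x2 : Pt
  x3 : Pt
  S : Set (Set Pt)
  B : Set (Set Pt)
  indep : AffineIndependent ℝ ![x1, x2, x3]
  finS : S.Finite
  finB : B.Finite
  seg_wf : ∀ s ∈ S ∪ B, ∃ a b : Pt, a ≠ b ∧ s = segment ℝ a b ∧
    a ∈ triBdry x1 x2 x3 ∧ b ∈ triBdry x1 x2 x3 ∧
    ∀ p ∈ openSegment ℝ a b, p ∉ triBdry x1 x2 x3
  /- (i) no three initial segments are concurrent … -/
  no_three_concurrent : ∀ s₁ ∈ S ∪ triEdges x1 x2 x3, ∀ s₂ ∈ S ∪ triEdges x1 x2 x3,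
    ∀ s₃ ∈ S ∪ triEdges x1 x2 x3, s₁ ≠ s₂ → s₁ ≠ s₃ → s₂ ≠ s₃ →
    ¬ ∃ p : Pt, p ∈ s₁ ∧ p ∈ s₂ ∧ p ∈ s₃
  /- … and through every intersection point of two initial segments, not both edges,
  there is a unique blocking segment … -/
  block_exists : ∀ s₁ ∈ S ∪ triEdges x1 x2 x3, ∀ s₂ ∈ S ∪ triEdges x1 x2 x3, s₁ ≠ s₂ →
    ¬ (s₁ ∈ triEdges x1 x2 x3 ∧ s₂ ∈ triEdges x1 x2 x3) →
    ∀ p : Pt, p ∈ s₁ → p ∈ s₂ → ∃! b, b ∈ B ∧ p ∈ b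
  /- … while through an intersection point of two edges there is at most one
  blocking segment. -/
  block_unique : ∀ s₁ ∈ S ∪ triEdges x1 x2 x3, ∀ s₂ ∈ S ∪ triEdges x1 x2 x3, s₁ ≠ s₂ →
    ∀ p : Pt, p ∈ s₁ → p ∈ s₂ → ∀ b₁ ∈ B, ∀ b₂ ∈ B, p ∈ b₁ → p ∈ b₂ → b₁ = b₂
  /- (ii) through every intersection point of an initial segment and a blocking segment
  there is a unique second initial segment. -/
  second_segment : ∀ s ∈ S ∪ triEdges x1 x2 x3, ∀ b ∈ B, ∀ p : Pt, p ∈ s → p ∈ b →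
    ∃! s', s' ∈ S ∪ triEdges x1 x2 x3 ∧ s' ≠ s ∧ p ∈ s'

namespace TBA

variable (Δ : TBA)

/-- The collection `𝒮̄` of initial segments. -/
def Sbar : Set (Set Pt) := Δ.S ∪ triEdges Δ.x1 Δ.x2 Δ.x3

/-- The (closed) triangle `T`. -/
def tri : Set Pt := convexHull ℝ {Δ.x1, Δ.x2, Δ.x3}

/-- The boundary `∂T`. -/
def bdry : Set Pt := triBdry Δ.x1 Δ.x2 Δ.x3

/-- A vertex of the arrangement: an intersection point of two initial segments. -/
def IsVertex (p : Pt) : Prop :=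
  ∃ s₁ ∈ Δ.Sbar, ∃ s₂ ∈ Δ.Sbar, s₁ ≠ s₂ ∧ p ∈ s₁ ∧ p ∈ s₂

/-- The segment `xy` is minimal if no vertex of the arrangement lies in its interior. -/
def MinimalSeg (x y : Pt) : Prop :=
  ∀ p ∈ openSegment ℝ x y, ¬ Δ.IsVertex p

/-- An `𝒮̄`-region: the closure of a connected component of `T \ ⋃ L` for some
subset `L` of `𝒮̄`. -/
def IsRegion (R : Set Pt) : Prop :=
  ∃ L ⊆ Δ.Sbar, ∃ p ∈ Δ.tri \ ⋃₀ L,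
    R = closure (connectedComponentIn (Δ.tri \ ⋃₀ L) p)

/-- A minimal `𝒮̄`-region: the closure of a connected component of `T \ ⋃ 𝒮̄`. -/
def IsMinRegion (R : Set Pt) : Prop :=
  ∃ p ∈ Δ.tri \ ⋃₀ Δ.Sbar,
    R = closure (connectedComponentIn (Δ.tri \ ⋃₀ Δ.Sbar) p)

/-- The set `s` contains an edge of the region `R`: it contains a nondegenerate
segment lying on the boundary of `R`. -/
def ContainsEdgeOf (_Δ : TBA) (s R : Set Pt) : Prop :=
  ∃ q₁ q₂ : Pt, q₁ ≠ q₂ ∧ segment ℝ q₁ q₂ ⊆ s ∩ frontier R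

/-- A vertex of the region `R`: a point of `R` that is the intersection of two initial
segments, each containing an edge of `R`. -/
def IsRegionVertex (R : Set Pt) (p : Pt) : Prop :=
  p ∈ R ∧ ∃ s₁ ∈ Δ.Sbar, ∃ s₂ ∈ Δ.Sbar, s₁ ≠ s₂ ∧ p ∈ s₁ ∧ p ∈ s₂ ∧
    Δ.ContainsEdgeOf s₁ R ∧ Δ.ContainsEdgeOf s₂ R

/-- A vertex `p` is internally blocked in the region `R` if the blocking segment
through `p` exists and meets the interior of `R`.  (Externally blocked means not
internally blocked.) -/
def InternallyBlocked (R : Set Pt) (p : Pt) : Prop :=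
  ∃ b ∈ Δ.B, p ∈ b ∧ (b ∩ interior R).Nonempty

/-- Two consecutive vertices of a region `R`: distinct vertices joined by an edge
lying on the boundary of `R`. -/
def Consec (R : Set Pt) (u v : Pt) : Prop :=
  u ≠ v ∧ Δ.IsRegionVertex R u ∧ Δ.IsRegionVertex R v ∧ segment ℝ u v ⊆ frontier R

/-- Condition (A): the arrangement is strong when for every minimal `𝒮̄`-region `R` and
consecutive vertices `v₁, v₂, v₃, v₄, v₅` in this order along `∂R`, if the line
`l(v₁v₂)` and the blocking segment `β(v₃)` intersect inside `T`, and `β(v₃)` meets the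
interior of `R`, then `l(v₁v₂)`, `β(v₃)` and `l(v₄v₅)` are concurrent. -/
def Strong : Prop :=
  ∀ R : Set Pt, Δ.IsMinRegion R →
  ∀ v₁ v₂ v₃ v₄ v₅ : Pt, List.Pairwise (· ≠ ·) [v₁, v₂, v₃, v₄, v₅] →
    Δ.Consec R v₁ v₂ → Δ.Consec R v₂ v₃ → Δ.Consec R v₃ v₄ → Δ.Consec R v₄ v₅ →
    ∀ b ∈ Δ.B, v₃ ∈ b → (b ∩ interior R).Nonempty →
    (∃ q ∈ Δ.tri, q ∈ affineSpan ℝ ({v₁, v₂} : Set Pt) ∧ q ∈ b) →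
    ∃ q : Pt, q ∈ b ∧ q ∈ affineSpan ℝ ({v₁, v₂} : Set Pt) ∧
      q ∈ affineSpan ℝ ({v₄, v₅} : Set Pt)

end TBA

/-! ### Affine functions along segments -/

lemma exists_param_of_mem_openSegment {x y z : Pt} (h : z ∈ openSegment ℝ x y) :
    ∃ t : ℝ, 0 < t ∧ t < 1 ∧ AffineMap.lineMap x y t = z := by
  rw [openSegment_eq_image_lineMap] at h
  obtain ⟨t, ht, rfl⟩ := h
  exact ⟨t, ht.1, ht.2, rfl⟩

lemma mem_openSegment_lineMap {x y : Pt} {t : ℝ} (h0 : 0 < t) (h1 : t < 1) :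
    AffineMap.lineMap x y t ∈ openSegment ℝ x y := by
  rw [openSegment_eq_image_lineMap]
  exact ⟨t, ⟨h0, h1⟩, rfl⟩

lemma affine_lineMap (f : Pt →ᵃ[ℝ] ℝ) (x y : Pt) (t : ℝ) :
    f (AffineMap.lineMap x y t) = (1 - t) * f x + t * f y := by
  rw [AffineMap.apply_lineMap, AffineMap.lineMap_apply]
  simp only [vsub_eq_sub, smul_eq_mul, vadd_eq_add]
  ring

lemma affine_openSegment (f : Pt →ᵃ[ℝ] ℝ) {x y z : Pt} (h : z ∈ openSegment ℝ x y) :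
    ∃ t : ℝ, 0 < t ∧ t < 1 ∧ f z = (1 - t) * f x + t * f y := by
  obtain ⟨t, h0, h1, rfl⟩ := exists_param_of_mem_openSegment h
  exact ⟨t, h0, h1, affine_lineMap f x y t⟩

/-- An affine function with opposite signs at the endpoints vanishes in between. -/
lemma exists_zero_of_mul_neg (f : Pt →ᵃ[ℝ] ℝ) {x y : Pt} (h : f x * f y < 0) :
    ∃ z ∈ openSegment ℝ x y, f z = 0 := by
  have hne : f x - f y ≠ 0 := by
    intro h0
    have : f x = f y := by linarith
    rw [this] at h
    nlinarith [mul_self_nonneg (f y)]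
  have hpos : 0 < f x / (f x - f y) ∧ f x / (f x - f y) < 1 := by
    rcases lt_or_gt_of_ne (show f x ≠ 0 by rintro h0; simp [h0] at h) with hx | hx
    · have hy : 0 < f y := by nlinarith
      constructor
      · exact div_pos_of_neg_of_neg hx (by linarith)
      · rw [div_lt_one_of_neg (by linarith)]; linarith
    · have hy : f y < 0 := by nlinarith
      constructor
      · exact div_pos hx (by linarith)
      · rw [div_lt_one (by linarith)]; linarith
  refine ⟨_, mem_openSegment_lineMap (x := x) (y := y) hpos.1 hpos.2, ?_⟩
  rw [affine_lineMap]
  field_simp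
  ring

/-- A zero strictly between two points, one of which is not a zero, separates them. -/
lemma mul_neg_of_zero_between (f : Pt →ᵃ[ℝ] ℝ) {x y z : Pt} (h : z ∈ openSegment ℝ x y)
    (hz : f z = 0) (hx : f x ≠ 0) : f x * f y < 0 := by
  obtain ⟨t, h0, h1, ht⟩ := affine_openSegment f h
  have h2 : 0 < f x * f x := mul_self_pos.mpr hx
  have h3 : t * (f x * f y) = -((1 - t) * (f x * f x)) := by
    have : t * f y = -((1 - t) * f x) := by linarith
    linear_combination f x * this
  have h4 : t * (f x * f y) < 0 := by
    rw [h3]; have := mul_pos (sub_pos.mpr h1) h2; linarith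
  exact (mul_neg_iff.mp h4).elim (fun h => h.2) (fun h => absurd h.1 (by linarith))

/-- An affine function vanishing at one end keeps the sign of the other end. -/
lemma mul_pos_of_zero_left (f : Pt →ᵃ[ℝ] ℝ) {x y z : Pt} (h : z ∈ openSegment ℝ x y)
    (hx : f x = 0) (hy : f y ≠ 0) : 0 < f z * f y := by
  obtain ⟨t, h0, h1, ht⟩ := affine_openSegment f h
  rw [ht, hx]
  have := mul_pos h0 (mul_self_pos.mpr hy)
  linarith

/-- If `y` separates `x` and `z` on a line and `f` vanishes at `z`, then `f x` and `f y`
have the same sign. -/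
lemma mul_pos_of_zero_right (f : Pt →ᵃ[ℝ] ℝ) {x y z : Pt} (h : y ∈ openSegment ℝ x z)
    (hz : f z = 0) (hx : f x ≠ 0) : 0 < f y * f x :=
  mul_pos_of_zero_left f (openSegment_symm ℝ x z ▸ h) hz hx

lemma mul_pos_between (f : Pt →ᵃ[ℝ] ℝ) {x y z : Pt} (h : z ∈ openSegment ℝ x y)
    (hxy : 0 < f x * f y) : 0 < f x * f z := by
  obtain ⟨t, h0, h1, ht⟩ := affine_openSegment f h
  have hx : f x ≠ 0 := by rintro h; simp [h] at hxy
  rw [ht]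
  have := mul_pos (sub_pos.mpr h1) (mul_self_pos.mpr hx)
  nlinarith [mul_pos h0 hxy]

lemma zero_of_ends (f : Pt →ᵃ[ℝ] ℝ) {x y z : Pt} (h : z ∈ openSegment ℝ x y)
    (hx : f x = 0) (hy : f y = 0) : f z = 0 := by
  obtain ⟨t, h0, h1, ht⟩ := affine_openSegment f h
  rw [ht, hx, hy]; ring

/-! ### Order of points on a segment -/

lemma mem_openSegment_comm {x y z : Pt} : z ∈ openSegment ℝ x y ↔ z ∈ openSegment ℝ y x := by
  rw [openSegment_symm]

lemma ne_left_of_mem_openSegment {x y z : Pt} (h : z ∈ openSegment ℝ x y) (hxy : x ≠ y) :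
    z ≠ x := by
  rintro rfl
  exact hxy (left_mem_openSegment_iff.mp h)

lemma ne_right_of_mem_openSegment {x y z : Pt} (h : z ∈ openSegment ℝ x y) (hxy : x ≠ y) :
    z ≠ y := by
  rintro rfl
  exact hxy (right_mem_openSegment_iff.mp h)

lemma lineMap_scale (x y : Pt) (t u : ℝ) :
    AffineMap.lineMap x (AffineMap.lineMap x y t) u = (AffineMap.lineMap x y (u * t) : Pt) := by
  ext <;> simp [AffineMap.lineMap_apply] <;> ring

lemma openSegment_trans {a p q b : Pt} (hq : q ∈ openSegment ℝ a p)
    (hp : p ∈ openSegment ℝ a b) : q ∈ openSegment ℝ a b := by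
  obtain ⟨t, h0, h1, rfl⟩ := exists_param_of_mem_openSegment hp
  obtain ⟨u, k0, k1, rfl⟩ := exists_param_of_mem_openSegment hq
  rw [lineMap_scale]
  exact mem_openSegment_lineMap (by positivity) (by nlinarith)

lemma openSegment_shift {a p q b : Pt} (hq : q ∈ openSegment ℝ a p)
    (hp : p ∈ openSegment ℝ a b) : p ∈ openSegment ℝ q b := by
  obtain ⟨t, h0, h1, rfl⟩ := exists_param_of_mem_openSegment hp
  obtain ⟨u, k0, k1, rfl⟩ := exists_param_of_mem_openSegment hq
  rw [lineMap_scale]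
  have hd : 0 < 1 - u * t := by nlinarith
  have hd0 : 1 - u * t ≠ 0 := hd.ne'
  have e : (AffineMap.lineMap a b t : Pt) =
      AffineMap.lineMap (AffineMap.lineMap a b (u * t) : Pt) b ((t - u * t) / (1 - u * t)) := by
    have hw := div_mul_cancel₀ (t - u * t) hd0
    ext
    · simp only [AffineMap.lineMap_apply, vsub_eq_sub, vadd_eq_add, Prod.fst_add, Prod.smul_fst,
        Prod.fst_sub, smul_eq_mul]
      linear_combination (a.1 - b.1) * hw
    · simp only [AffineMap.lineMap_apply, vsub_eq_sub, vadd_eq_add, Prod.snd_add, Prod.smul_snd,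
        Prod.snd_sub, smul_eq_mul]
      linear_combination (a.2 - b.2) * hw
  rw [e]
  exact mem_openSegment_lineMap (div_pos (by nlinarith) hd) (by rw [div_lt_one hd]; linarith)

lemma openSegment_trichotomy {a b p q : Pt} (hp : p ∈ openSegment ℝ a b)
    (hq : q ∈ openSegment ℝ a b) :
    p = q ∨ q ∈ openSegment ℝ a p ∨ p ∈ openSegment ℝ a q := by
  obtain ⟨t, h0, h1, rfl⟩ := exists_param_of_mem_openSegment hp
  obtain ⟨u, k0, k1, rfl⟩ := exists_param_of_mem_openSegment hq
  rcases lt_trichotomy t u with h | h | h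
  · right; right
    have : (AffineMap.lineMap a b t : Pt) =
        AffineMap.lineMap a (AffineMap.lineMap a b u : Pt) (t / u) := by
      rw [lineMap_scale]; congr 1; field_simp
    rw [this]
    exact mem_openSegment_lineMap (by positivity) (by rwa [div_lt_one k0])
  · left; rw [h]
  · right; left
    have : (AffineMap.lineMap a b u : Pt) =
        AffineMap.lineMap a (AffineMap.lineMap a b t : Pt) (u / t) := by
      rw [lineMap_scale]; congr 1; field_simp
    rw [this]
    exact mem_openSegment_lineMap (by positivity) (by rwa [div_lt_one h0])

/-- Two prolongations of `a v` beyond `v` are comparable. -/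
lemma openSegment_prolong {a v p q : Pt} (hp : v ∈ openSegment ℝ a p)
    (hq : v ∈ openSegment ℝ a q) :
    p = q ∨ q ∈ openSegment ℝ v p ∨ p ∈ openSegment ℝ v q := by
  obtain ⟨t, h0, h1, ht⟩ := exists_param_of_mem_openSegment hp
  obtain ⟨u, k0, k1, hu⟩ := exists_param_of_mem_openSegment hq
  have ep : p = AffineMap.lineMap a v (1 / t) := by
    rw [← ht, lineMap_scale, one_div_mul_cancel h0.ne', AffineMap.lineMap_apply_one]
  have eq : q = AffineMap.lineMap a v (1 / u) := by
    rw [← hu, lineMap_scale, one_div_mul_cancel k0.ne', AffineMap.lineMap_apply_one]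
  have ht1 : 0 < 1 - t := by linarith
  have hu1 : 0 < 1 - u := by linarith
  rcases lt_trichotomy t u with h | h | h
  · right; left
    have : q = AffineMap.lineMap v p ((1 / u - 1) / (1 / t - 1)) := by
      rw [ep, eq]
      have : 1 / t - 1 ≠ 0 := by
        have : 1 < 1 / t := by rw [lt_div_iff₀ h0]; linarith
        linarith
      ext <;> simp [AffineMap.lineMap_apply] <;> field_simp <;> ring
    rw [this]
    have h2 : 1 < 1 / u := by rw [lt_div_iff₀ k0]; linarith
    have h3 : 1 / u < 1 / t := one_div_lt_one_div_of_lt h0 h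
    exact mem_openSegment_lineMap (div_pos (by linarith) (by linarith))
      (by rw [div_lt_one (by linarith)]; linarith)
  · left; rw [ep, eq, h]
  · right; right
    have : p = AffineMap.lineMap v q ((1 / t - 1) / (1 / u - 1)) := by
      rw [ep, eq]
      have : 1 / u - 1 ≠ 0 := by
        have : 1 < 1 / u := by rw [lt_div_iff₀ k0]; linarith
        linarith
      ext <;> simp [AffineMap.lineMap_apply] <;> field_simp <;> ring
    rw [this]
    have h2 : 1 < 1 / t := by rw [lt_div_iff₀ h0]; linarith
    have h3 : 1 / t < 1 / u := one_div_lt_one_div_of_lt k0 h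
    exact mem_openSegment_lineMap (div_pos (by linarith) (by linarith))
      (by rw [div_lt_one (by linarith)]; linarith)

/-! ### Lines in the plane -/

/-- The affine function vanishing on the line through `u` and `w`. -/
def lineFn (u w : Pt) : Pt →ᵃ[ℝ] ℝ :=
  ((w.1 - u.1) • LinearMap.snd ℝ ℝ ℝ - (w.2 - u.2) • LinearMap.fst ℝ ℝ ℝ).toAffineMap -
    AffineMap.const ℝ Pt ((w.1 - u.1) * u.2 - (w.2 - u.2) * u.1)

lemma lineFn_apply (u w z : Pt) :
    lineFn u w z = (w.1 - u.1) * (z.2 - u.2) - (w.2 - u.2) * (z.1 - u.1) := by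
  simp [lineFn]
  ring

lemma lineFn_left (u w : Pt) : lineFn u w u = 0 := by
  rw [lineFn_apply]; ring

lemma lineFn_right (u w : Pt) : lineFn u w w = 0 := by
  rw [lineFn_apply]; ring

lemma exists_lineFn_ne_zero {u w : Pt} (h : u ≠ w) : ∃ z, lineFn u w z ≠ 0 := by
  by_contra! H
  apply h
  have h1 := H (u.1, u.2 + 1)
  have h2 := H (u.1 + 1, u.2)
  rw [lineFn_apply] at h1 h2
  ext
  · simp at h1; linarith
  · simp at h2; linarith

lemma exists_lineMap_of_lineFn_eq_zero {u w z : Pt} (h : u ≠ w) (hz : lineFn u w z = 0) :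
    ∃ t : ℝ, z = AffineMap.lineMap u w t := by
  rw [lineFn_apply] at hz
  by_cases h1 : w.1 - u.1 = 0
  · have h2 : w.2 - u.2 ≠ 0 := fun h2 => h (Prod.ext (by linarith) (by linarith))
    refine ⟨(z.2 - u.2) / (w.2 - u.2), ?_⟩
    have hz1 : z.1 - u.1 = 0 := by
      have : (w.2 - u.2) * (z.1 - u.1) = 0 := by rw [h1] at hz; linarith
      exact (mul_eq_zero.mp this).resolve_left h2
    ext
    · simp [AffineMap.lineMap_apply, h1]; linarith
    · simp [AffineMap.lineMap_apply, h2]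
  · refine ⟨(z.1 - u.1) / (w.1 - u.1), ?_⟩
    ext
    · simp [AffineMap.lineMap_apply, h1]
    · simp [AffineMap.lineMap_apply]
      field_simp
      linarith

/-- An affine function with two distinct zeros is a multiple of `lineFn`. -/
lemma eq_mul_lineFn (f : Pt →ᵃ[ℝ] ℝ) {x y : Pt} (hxy : x ≠ y) (hx : f x = 0) (hy : f y = 0) :
    ∃ r : ℝ, ∀ z, f z = r * lineFn x y z := by
  have key : ∀ z, f z = f.linear (1, 0) * (z.1 - x.1) + f.linear (0, 1) * (z.2 - x.2) := by
    intro z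
    have h1 : f z = f.linear (z - x) + f x := by
      have := f.map_vadd x (z - x)
      simpa using this
    have h2 : z - x = (z.1 - x.1) • ((1 : ℝ), (0 : ℝ)) + (z.2 - x.2) • ((0 : ℝ), (1 : ℝ)) := by
      ext <;> simp
    rw [h1, hx, h2, map_add, map_smul, map_smul, smul_eq_mul, smul_eq_mul]
    ring
  have hy' := key y
  rw [hy] at hy'
  set α := f.linear (1, 0)
  set β := f.linear (0, 1)
  by_cases h1 : y.1 - x.1 = 0
  · have h2 : y.2 - x.2 ≠ 0 := fun h2 => hxy (Prod.ext (by linarith) (by linarith))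
    have hβ : β = 0 := by
      rw [h1] at hy'
      have : β * (y.2 - x.2) = 0 := by linarith
      exact (mul_eq_zero.mp this).resolve_right h2
    refine ⟨-α / (y.2 - x.2), fun z => ?_⟩
    rw [key, lineFn_apply, h1, hβ]
    field_simp
    ring
  · refine ⟨β / (y.1 - x.1), fun z => ?_⟩
    rw [key, lineFn_apply]
    field_simp
    linear_combination (x.1 - z.1) * hy'

/-- Two nonzero affine functions sharing two distinct zeros have the same zeros. -/
lemma zero_iff_of_two_zeros {f g : Pt →ᵃ[ℝ] ℝ} (hf : ∃ z, f z ≠ 0) (hg : ∃ z, g z ≠ 0)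
    {x y : Pt} (hxy : x ≠ y) (hfx : f x = 0) (hfy : f y = 0) (hgx : g x = 0) (hgy : g y = 0)
    (z : Pt) : f z = 0 ↔ g z = 0 := by
  obtain ⟨r, hr⟩ := eq_mul_lineFn f hxy hfx hfy
  obtain ⟨r', hr'⟩ := eq_mul_lineFn g hxy hgx hgy
  have h1 : r ≠ 0 := by
    rintro rfl; obtain ⟨z, hz⟩ := hf; exact hz (by rw [hr]; ring)
  have h2 : r' ≠ 0 := by
    rintro rfl; obtain ⟨z, hz⟩ := hg; exact hz (by rw [hr']; ring)
  rw [hr, hr']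
  simp [h1, h2]

lemma openSegment_of_lineMap_neg {u w : Pt} {t : ℝ} (ht : t < 0) :
    u ∈ openSegment ℝ (AffineMap.lineMap u w t) w := by
  have h1 : (1 - t) ≠ 0 := by linarith
  have e : u = AffineMap.lineMap (AffineMap.lineMap u w t : Pt) w (-t / (1 - t)) := by
    have hw := div_mul_cancel₀ (-t) h1
    ext
    · simp only [AffineMap.lineMap_apply, vsub_eq_sub, vadd_eq_add, Prod.fst_add, Prod.smul_fst,
        Prod.fst_sub, smul_eq_mul]
      linear_combination (u.1 - w.1) * hw
    · simp only [AffineMap.lineMap_apply, vsub_eq_sub, vadd_eq_add, Prod.snd_add, Prod.smul_snd,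
        Prod.snd_sub, smul_eq_mul]
      linear_combination (u.2 - w.2) * hw
  have h2 := mem_openSegment_lineMap (x := (AffineMap.lineMap u w t : Pt)) (y := w)
    (t := -t / (1 - t)) (div_pos (by linarith) (by linarith))
    (by rw [div_lt_one (by linarith)]; linarith)
  rwa [← e] at h2

namespace TBA

variable (Δ : TBA)

/-! ### The triangle in barycentric coordinates -/

/-- The vertices of `T` as an affine basis. -/
def basis : AffineBasis (Fin 3) ℝ Pt :=
  ⟨![Δ.x1, Δ.x2, Δ.x3], Δ.indep,
    (Δ.indep.affineSpan_eq_top_iff_card_eq_finrank_add_one).mpr (by simp)⟩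

/-- The barycentric coordinates. -/
def cd (i : Fin 3) : Pt →ᵃ[ℝ] ℝ := Δ.basis.coord i

@[simp] lemma cd_x1 (i : Fin 3) : Δ.cd i Δ.x1 = if i = 0 then 1 else 0 :=
  Δ.basis.coord_apply i 0

@[simp] lemma cd_x2 (i : Fin 3) : Δ.cd i Δ.x2 = if i = 1 then 1 else 0 :=
  Δ.basis.coord_apply i 1

@[simp] lemma cd_x3 (i : Fin 3) : Δ.cd i Δ.x3 = if i = 2 then 1 else 0 :=
  Δ.basis.coord_apply i 2

lemma sum_cd (x : Pt) : Δ.cd 0 x + Δ.cd 1 x + Δ.cd 2 x = 1 := by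
  have := Δ.basis.sum_coord_apply_eq_one x
  rwa [Fin.sum_univ_three] at this

lemma ext_cd {x y : Pt} (h : ∀ i, Δ.cd i x = Δ.cd i y) : x = y := Δ.basis.ext_elem h

lemma mem_tri {x : Pt} : x ∈ Δ.tri ↔ ∀ i, 0 ≤ Δ.cd i x := by
  have h : ({Δ.x1, Δ.x2, Δ.x3} : Set Pt) = range Δ.basis := by
    ext z
    simp only [mem_insert_iff, mem_singleton_iff, mem_range, Fin.exists_fin_succ]
    simp [basis, eq_comm]
    rfl
  rw [tri, h, AffineBasis.convexHull_eq_nonneg_coord]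
  rfl

/-- The edge of `T` opposite to a vertex. -/
def edge (i : Fin 3) : Set Pt := {x | x ∈ Δ.tri ∧ Δ.cd i x = 0}

lemma segment_eq_edge {y z : Pt} {i j k : Fin 3} (hij : ∀ l, l = i ∨ l = j ∨ l = k)
    (hj : ∀ l, Δ.cd l y = if l = j then 1 else 0) (hk : ∀ l, Δ.cd l z = if l = k then 1 else 0)
    (h1 : i ≠ j) (h2 : i ≠ k) (h3 : j ≠ k)
    (hs : ∀ x, Δ.cd i x + Δ.cd j x + Δ.cd k x = 1) : segment ℝ y z = Δ.edge i := by
  ext x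
  rw [segment_eq_image_lineMap]
  constructor
  · rintro ⟨t, ⟨h0, h1'⟩, rfl⟩
    refine ⟨Δ.mem_tri.mpr fun l => ?_, ?_⟩
    · rw [affine_lineMap, hj, hk]
      split_ifs <;> linarith
    · rw [affine_lineMap, hj, hk, if_neg h1, if_neg h2]; ring
  · rintro ⟨hx, h0⟩
    have hx' := Δ.mem_tri.mp hx
    have := hs x
    refine ⟨Δ.cd k x, ⟨hx' k, by linarith [hx' j]⟩, Δ.ext_cd fun l => ?_⟩
    rw [affine_lineMap, hj, hk]
    rcases hij l with rfl | rfl | rfl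
    · rw [if_neg h1, if_neg h2]; linarith
    · rw [if_pos rfl, if_neg h3]; linarith
    · rw [if_neg h3.symm, if_pos rfl]; linarith

lemma segment_x1_x2 : segment ℝ Δ.x1 Δ.x2 = Δ.edge 2 :=
  Δ.segment_eq_edge (j := 0) (k := 1) (by decide) (fun _ => by simp) (fun _ => by simp)
    (by decide) (by decide) (by decide) (fun x => by linarith [Δ.sum_cd x])

lemma segment_x2_x3 : segment ℝ Δ.x2 Δ.x3 = Δ.edge 0 :=
  Δ.segment_eq_edge (j := 1) (k := 2) (by decide) (fun _ => by simp) (fun _ => by simp)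
    (by decide) (by decide) (by decide) (fun x => by linarith [Δ.sum_cd x])

lemma segment_x3_x1 : segment ℝ Δ.x3 Δ.x1 = Δ.edge 1 :=
  Δ.segment_eq_edge (j := 2) (k := 0) (by decide) (fun _ => by simp) (fun _ => by simp)
    (by decide) (by decide) (by decide) (fun x => by linarith [Δ.sum_cd x])

lemma mem_triEdges {s : Set Pt} : s ∈ triEdges Δ.x1 Δ.x2 Δ.x3 ↔ ∃ i, s = Δ.edge i := by
  simp only [triEdges, mem_insert_iff, mem_singleton_iff, segment_x1_x2, segment_x2_x3,
    segment_x3_x1, Fin.exists_fin_succ]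
  simp
  tauto

lemma mem_bdry {x : Pt} : x ∈ triBdry Δ.x1 Δ.x2 Δ.x3 ↔ x ∈ Δ.tri ∧ ∃ i, Δ.cd i x = 0 := by
  simp only [triBdry, segment_x1_x2, segment_x2_x3, segment_x3_x1, mem_union, edge, mem_ofPred_eq,
    Fin.exists_fin_succ]
  simp
  tauto

lemma edge_injective : Function.Injective Δ.edge := by
  intro i j h
  by_contra hij
  have : ∃ x ∈ Δ.tri, Δ.cd i x = 0 ∧ Δ.cd j x ≠ 0 := by
    fin_cases j
    · refine ⟨Δ.x1, Δ.mem_tri.mpr fun l => ?_, ?_⟩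
      · rw [cd_x1]; split_ifs <;> norm_num
      · simpa using hij
    · refine ⟨Δ.x2, Δ.mem_tri.mpr fun l => ?_, ?_⟩
      · rw [cd_x2]; split_ifs <;> norm_num
      · simpa using hij
    · refine ⟨Δ.x3, Δ.mem_tri.mpr fun l => ?_, ?_⟩
      · rw [cd_x3]; split_ifs <;> norm_num
      · simpa using hij
  obtain ⟨x, hx, h1, h2⟩ := this
  have : x ∈ Δ.edge i := ⟨hx, h1⟩
  rw [h] at this
  exact h2 this.2

lemma edge_mem_Sbar (i : Fin 3) : Δ.edge i ∈ Δ.Sbar :=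
  Or.inr (Δ.mem_triEdges.mpr ⟨i, rfl⟩)

lemma convex_tri : Convex ℝ Δ.tri := convex_convexHull ℝ _

lemma mem_tri_of_mem_openSegment {x y z : Pt} (h : z ∈ openSegment ℝ x y) (hx : x ∈ Δ.tri)
    (hy : y ∈ Δ.tri) : z ∈ Δ.tri :=
  Δ.convex_tri.segment_subset hx hy (openSegment_subset_segment ℝ x y h)

lemma zero_left_of_mem_openSegment (i : Fin 3) {x y z : Pt} (h : z ∈ openSegment ℝ x y)
    (hx : x ∈ Δ.tri) (hy : y ∈ Δ.tri) (hz : Δ.cd i z = 0) : Δ.cd i x = 0 := by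
  obtain ⟨t, h0, h1, ht⟩ := affine_openSegment (Δ.cd i) h
  have h3 := Δ.mem_tri.mp hx i
  have h4 := Δ.mem_tri.mp hy i
  rw [hz] at ht
  have h5 : (1 - t) * Δ.cd i x = 0 := by
    nlinarith [mul_nonneg (sub_nonneg.mpr h1.le) h3, mul_nonneg h0.le h4]
  exact (mul_eq_zero.mp h5).resolve_left (by linarith)

lemma zero_right_of_mem_openSegment (i : Fin 3) {x y z : Pt} (h : z ∈ openSegment ℝ x y)
    (hx : x ∈ Δ.tri) (hy : y ∈ Δ.tri) (hz : Δ.cd i z = 0) : Δ.cd i y = 0 :=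
  Δ.zero_left_of_mem_openSegment i (mem_openSegment_comm.mp h) hy hx hz

/-! ### Chords and their affine functions -/

lemma exists_fn {c : Set Pt} (hc : c ∈ Δ.Sbar ∪ Δ.B) :
    ∃ f : Pt →ᵃ[ℝ] ℝ, (∀ x, x ∈ c ↔ x ∈ Δ.tri ∧ f x = 0) ∧ (∃ z, f z ≠ 0) ∧
      ∀ i, c = Δ.edge i → f = Δ.cd i := by
  by_cases he : ∃ i, c = Δ.edge i
  · obtain ⟨i, rfl⟩ := he
    refine ⟨Δ.cd i, fun x => Iff.rfl, ?_, fun j h => by rw [Δ.edge_injective h]⟩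
    fin_cases i
    · exact ⟨Δ.x1, by simp⟩
    · exact ⟨Δ.x2, by simp⟩
    · exact ⟨Δ.x3, by simp⟩
  have hc' : c ∈ Δ.S ∪ Δ.B := by
    rcases hc with (h | h) | h
    · exact Or.inl h
    · exact absurd (Δ.mem_triEdges.mp h) he
    · exact Or.inr h
  obtain ⟨u, w, huw, rfl, hu, hw, ho⟩ := Δ.seg_wf c hc'
  rw [mem_bdry] at hu hw
  have hno : ∀ i, ¬ (Δ.cd i u = 0 ∧ Δ.cd i w = 0) := by
    rintro i ⟨h1, h2⟩
    have hm := mem_openSegment_lineMap (x := u) (y := w) (t := 1 / 2) (by norm_num) (by norm_num)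
    exact ho _ hm (Δ.mem_bdry.mpr ⟨Δ.mem_tri_of_mem_openSegment hm hu.1 hw.1, i,
      zero_of_ends _ hm h1 h2⟩)
  refine ⟨lineFn u w, fun x => ⟨fun hx => ⟨Δ.convex_tri.segment_subset hu.1 hw.1 hx, ?_⟩, ?_⟩,
    exists_lineFn_ne_zero huw, fun i h => absurd ⟨i, h⟩ he⟩
  · rw [segment_eq_image_lineMap] at hx
    obtain ⟨t, -, rfl⟩ := hx
    rw [affine_lineMap, lineFn_left, lineFn_right]; ring
  · rintro ⟨hx, h0⟩
    obtain ⟨t, rfl⟩ := exists_lineMap_of_lineFn_eq_zero huw h0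
    rcases lt_or_ge t 0 with ht | ht
    · obtain ⟨i, hi⟩ := hu.2
      exact absurd ⟨hi, Δ.zero_right_of_mem_openSegment i (openSegment_of_lineMap_neg ht) hx
        hw.1 hi⟩ (hno i)
    rcases lt_or_ge 1 t with ht1 | ht1
    · obtain ⟨i, hi⟩ := hw.2
      rw [← AffineMap.lineMap_apply_one_sub] at hx
      exact absurd ⟨Δ.zero_right_of_mem_openSegment i
        (openSegment_of_lineMap_neg (by linarith)) hx hu.1 hi, hi⟩ (hno i)
    · rw [segment_eq_image_lineMap]
      exact ⟨t, ⟨ht, ht1⟩, rfl⟩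

/-- An affine function cutting out the chord `c`. -/
def fn (c : Set Pt) : Pt →ᵃ[ℝ] ℝ :=
  open Classical in if h : c ∈ Δ.Sbar ∪ Δ.B then (Δ.exists_fn h).choose else 0

lemma fn_spec {c : Set Pt} (hc : c ∈ Δ.Sbar ∪ Δ.B) :
    (∀ x, x ∈ c ↔ x ∈ Δ.tri ∧ Δ.fn c x = 0) ∧ (∃ z, Δ.fn c z ≠ 0) ∧
      ∀ i, c = Δ.edge i → Δ.fn c = Δ.cd i := by
  rw [fn, dif_pos hc]
  exact (Δ.exists_fn hc).choose_spec

variable {Δ}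

lemma Sbar_chord {c : Set Pt} (hc : c ∈ Δ.Sbar) : c ∈ Δ.Sbar ∪ Δ.B := Or.inl hc

lemma B_chord {c : Set Pt} (hc : c ∈ Δ.B) : c ∈ Δ.Sbar ∪ Δ.B := Or.inr hc

lemma mem_chord {c : Set Pt} (hc : c ∈ Δ.Sbar ∪ Δ.B) {x : Pt} :
    x ∈ c ↔ x ∈ Δ.tri ∧ Δ.fn c x = 0 := (Δ.fn_spec hc).1 x

lemma chord_tri {c : Set Pt} (hc : c ∈ Δ.Sbar ∪ Δ.B) {x : Pt} (hx : x ∈ c) : x ∈ Δ.tri :=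
  ((mem_chord hc).mp hx).1

lemma fn_zero {c : Set Pt} (hc : c ∈ Δ.Sbar ∪ Δ.B) {x : Pt} (hx : x ∈ c) : Δ.fn c x = 0 :=
  ((mem_chord hc).mp hx).2

lemma fn_ne {c : Set Pt} (hc : c ∈ Δ.Sbar ∪ Δ.B) {x : Pt} (hx : x ∈ Δ.tri) (h : x ∉ c) :
    Δ.fn c x ≠ 0 := fun h0 => h ((mem_chord hc).mpr ⟨hx, h0⟩)

lemma fn_edge (i : Fin 3) : Δ.fn (Δ.edge i) = Δ.cd i :=
  (Δ.fn_spec (Sbar_chord (Δ.edge_mem_Sbar i))).2.2 i rfl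

lemma openSegment_subset_chord {c : Set Pt} (hc : c ∈ Δ.Sbar ∪ Δ.B) {x y z : Pt} (hx : x ∈ c)
    (hy : y ∈ c) (hz : z ∈ openSegment ℝ x y) : z ∈ c :=
  (mem_chord hc).mpr ⟨Δ.mem_tri_of_mem_openSegment hz (chord_tri hc hx) (chord_tri hc hy),
    zero_of_ends _ hz (fn_zero hc hx) (fn_zero hc hy)⟩

lemma chord_eq {c d : Set Pt} (hc : c ∈ Δ.Sbar ∪ Δ.B) (hd : d ∈ Δ.Sbar ∪ Δ.B) {x y : Pt}
    (hxy : x ≠ y) (hxc : x ∈ c) (hyc : y ∈ c) (hxd : x ∈ d) (hyd : y ∈ d) : c = d := by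
  ext z
  rw [mem_chord hc, mem_chord hd, zero_iff_of_two_zeros (Δ.fn_spec hc).2.1 (Δ.fn_spec hd).2.1 hxy
    (fn_zero hc hxc) (fn_zero hc hyc) (fn_zero hd hxd) (fn_zero hd hyd)]

lemma Sbar_unique {c d : Set Pt} (hc : c ∈ Δ.Sbar) (hd : d ∈ Δ.Sbar) (hcd : c ≠ d) {x y : Pt}
    (hxc : x ∈ c) (hyc : y ∈ c) (hxd : x ∈ d) (hyd : y ∈ d) : x = y := by
  by_contra h
  exact hcd (chord_eq (Sbar_chord hc) (Sbar_chord hd) h hxc hyc hxd hyd)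

lemma finite_Sbar : Δ.Sbar.Finite := by
  refine Δ.finS.union ?_
  unfold triEdges
  exact toFinite _

lemma finite_vertices : {x | Δ.IsVertex x}.Finite := by
  have : {x | Δ.IsVertex x} ⊆ ⋃ c ∈ Δ.Sbar, ⋃ d ∈ Δ.Sbar \ {c}, c ∩ d := by
    rintro x ⟨c, hc, d, hd, hcd, hxc, hxd⟩
    simp only [mem_iUnion]
    exact ⟨c, hc, d, ⟨hd, hcd.symm⟩, hxc, hxd⟩
  refine Finite.subset (finite_Sbar.biUnion fun c hc => ?_) this
  refine (finite_Sbar.subset sdiff_subset).biUnion fun d hd => ?_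
  refine Set.Subsingleton.finite ?_
  rintro x ⟨h1, h2⟩ y ⟨h3, h4⟩
  exact Sbar_unique hc hd.1 (Ne.symm hd.2) h1 h3 h2 h4

lemma infinite_openSegment {x y : Pt} (h : x ≠ y) : (openSegment ℝ x y).Infinite := by
  rw [openSegment_eq_image_lineMap]
  refine Set.Infinite.image (fun _ _ _ _ h' => AffineMap.lineMap_injective ℝ h h') ?_
  exact Ioo_infinite (by norm_num)

lemma isVertex_of_block {s b : Set Pt} (hs : s ∈ Δ.Sbar) (hb : b ∈ Δ.B) {x : Pt} (hxs : x ∈ s)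
    (hxb : x ∈ b) : Δ.IsVertex x := by
  obtain ⟨s', ⟨h1, h2, h3⟩, -⟩ := Δ.second_segment s hs b hb x hxs hxb
  exact ⟨s, hs, s', h1, h2.symm, hxs, h3⟩

lemma block_unique_point {s b : Set Pt} (hs : s ∈ Δ.Sbar) (hb : b ∈ Δ.B) {x y : Pt}
    (hxs : x ∈ s) (hys : y ∈ s) (hxb : x ∈ b) (hyb : y ∈ b) : x = y := by
  by_contra h
  refine infinite_openSegment h ((finite_vertices (Δ := Δ)).subset fun z hz => ?_)
  exact isVertex_of_block hs hb (openSegment_subset_chord (Sbar_chord hs) hxs hys hz)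
    (openSegment_subset_chord (B_chord hb) hxb hyb hz)

lemma no_three {r s t : Set Pt} (hr : r ∈ Δ.Sbar) (hs : s ∈ Δ.Sbar) (ht : t ∈ Δ.Sbar) {p : Pt}
    (hpr : p ∈ r) (hps : p ∈ s) (hpt : p ∈ t) (hrs : r ≠ s) : t = r ∨ t = s := by
  by_contra! h
  exact Δ.no_three_concurrent r hr s hs t ht hrs h.1.symm h.2.symm ⟨p, hpr, hps, hpt⟩

/-! ### Proper segments and the boundary -/

lemma edge_of_bdry {x : Pt} (hx : x ∈ Δ.bdry) : ∃ i, x ∈ Δ.edge i := by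
  obtain ⟨h, i, hi⟩ := Δ.mem_bdry.mp hx
  exact ⟨i, h, hi⟩

lemma not_edge_of_mul_neg {g : Set Pt} (hg : g ∈ Δ.Sbar) {x y : Pt} (hx : x ∈ Δ.tri)
    (hy : y ∈ Δ.tri) (h : Δ.fn g x * Δ.fn g y < 0) (i : Fin 3) : g ≠ Δ.edge i := by
  rintro rfl
  rw [fn_edge] at h
  exact absurd h (not_lt.mpr (mul_nonneg (Δ.mem_tri.mp hx i) (Δ.mem_tri.mp hy i)))

lemma not_bdry_of_proper {g : Set Pt} (hg : g ∈ Δ.Sbar) (hp : ∀ i, g ≠ Δ.edge i) {x y z : Pt}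
    (hx : x ∈ g) (hy : y ∈ g) (hxy : x ≠ y) (hz : z ∈ openSegment ℝ x y) : z ∉ Δ.bdry := by
  intro h
  obtain ⟨i, hi⟩ := edge_of_bdry h
  have tx := chord_tri (Sbar_chord hg) hx
  have ty := chord_tri (Sbar_chord hg) hy
  exact hxy (Sbar_unique hg (Δ.edge_mem_Sbar i) (hp i) hx hy
    ⟨tx, Δ.zero_left_of_mem_openSegment i hz tx ty hi.2⟩
    ⟨ty, Δ.zero_right_of_mem_openSegment i hz tx ty hi.2⟩)

lemma proper_of_not_bdry {g : Set Pt} {z : Pt} (hz : z ∈ g) (h : z ∉ Δ.bdry) (i : Fin 3) :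
    g ≠ Δ.edge i := by
  rintro rfl
  exact h (Δ.mem_bdry.mpr ⟨hz.1, i, hz.2⟩)

/-- A proper segment extends beyond any of its interior points up to a vertex. -/
lemma exists_vertex_beyond {s : Set Pt} (hs : s ∈ Δ.Sbar) {v y : Pt} (hv : v ∈ s) (hy : y ∈ s)
    (hvy : v ≠ y) (hb : v ∉ Δ.bdry) :
    ∃ z ∈ s, Δ.IsVertex z ∧ v ∈ openSegment ℝ y z := by
  have hp := proper_of_not_bdry hv hb
  have hS : s ∈ Δ.S := hs.resolve_right fun h => by
    obtain ⟨i, hi⟩ := Δ.mem_triEdges.mp h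
    exact hp i hi
  obtain ⟨u, w, huw, rfl, hu, hw, ho⟩ := Δ.seg_wf s (Or.inl hS)
  have hu0 : u ≠ v := by rintro rfl; exact hb hu
  have hw0 : w ≠ v := by rintro rfl; exact hb hw
  have hv' : v ∈ openSegment ℝ u w := mem_openSegment_of_ne_left_right hu0 hw0 hv
  have vert : ∀ z ∈ segment ℝ u w, z ∈ Δ.bdry → Δ.IsVertex z := by
    intro z hz hzb
    obtain ⟨i, hi⟩ := edge_of_bdry hzb
    exact ⟨_, hs, _, Δ.edge_mem_Sbar i, hp i, hz, hi⟩
  have hul := left_mem_segment ℝ u w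
  have hwr := right_mem_segment ℝ u w
  by_cases h1 : u = y
  · exact ⟨w, hwr, vert w hwr hw, h1 ▸ hv'⟩
  by_cases h2 : w = y
  · exact ⟨u, hul, vert u hul hu, h2 ▸ mem_openSegment_comm.mp hv'⟩
  have hy' : y ∈ openSegment ℝ u w := mem_openSegment_of_ne_left_right h1 h2 hy
  rcases openSegment_trichotomy hv' hy' with h | h | h
  · exact absurd h hvy
  · exact ⟨w, hwr, vert w hwr hw, openSegment_shift h hv'⟩
  · refine ⟨u, hul, vert u hul hu, mem_openSegment_comm.mp h⟩

/-- The vertex following `v` on `s` in the direction of `y`. -/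
lemma exists_next {s : Set Pt} (hs : s ∈ Δ.Sbar) {v y : Pt} (hv : v ∈ s) (hy : y ∈ s)
    (hvert : Δ.IsVertex y) (hvy : v ≠ y) :
    ∃ u ∈ s, Δ.IsVertex u ∧ u ≠ v ∧ (u = y ∨ u ∈ openSegment ℝ v y) ∧ Δ.MinimalSeg v u := by
  have hfin : {x | Δ.IsVertex x ∧ (x = y ∨ x ∈ openSegment ℝ v y)}.Finite :=
    finite_vertices.subset fun x hx => hx.1
  obtain ⟨f, hf⟩ : ∃ f : Pt →ᵃ[ℝ] ℝ, f v = 0 ∧ 0 < f y := by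
    by_cases h1 : v.1 = y.1
    · have h2 : y.2 - v.2 ≠ 0 := fun h2 => hvy (Prod.ext h1 (by linarith))
      refine ⟨(y.2 - v.2) • ((LinearMap.snd ℝ ℝ ℝ).toAffineMap - AffineMap.const ℝ Pt v.2),
        by simp, ?_⟩
      simpa using mul_self_pos.mpr h2
    · have h2 : y.1 - v.1 ≠ 0 := fun h2 => h1 (by linarith)
      refine ⟨(y.1 - v.1) • ((LinearMap.fst ℝ ℝ ℝ).toAffineMap - AffineMap.const ℝ Pt v.1),
        by simp, ?_⟩
      simpa using mul_self_pos.mpr h2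
  obtain ⟨u, ⟨hu1, hu2⟩, hmin⟩ := exists_min_image _ f hfin ⟨y, hvert, Or.inl rfl⟩
  have huv : u ≠ v := by
    rcases hu2 with rfl | h
    · exact hvy.symm
    · exact ne_left_of_mem_openSegment h hvy
  refine ⟨u, ?_, hu1, huv, hu2, ?_⟩
  · rcases hu2 with rfl | h
    · exact hy
    · exact openSegment_subset_chord (Sbar_chord hs) hv hy h
  · intro p hp hpv
    have hpy : p ∈ openSegment ℝ v y := by
      rcases hu2 with rfl | h
      · exact hp
      · exact openSegment_trans hp h
    have h1 := hmin p ⟨hpv, Or.inr hpy⟩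
    obtain ⟨t, h0, h1', ht⟩ := affine_openSegment f hp
    obtain ⟨t', h0', h1'', ht'⟩ := affine_openSegment f hpy
    rw [hf.1] at ht ht'
    have : 0 < f p := by rw [ht']; have := mul_pos h0' hf.2; linarith
    have : 0 < f u := by
      by_contra! hu
      have := mul_nonneg h0.le (neg_nonneg.mpr hu)
      linarith
    have := mul_pos (sub_pos.mpr h1') this
    linarith

end TBA

/-! ### Signs -/

lemma opp_opp {x y z : ℝ} (h1 : x * y < 0) (h2 : y * z < 0) : 0 < x * z := by
  rcases mul_neg_iff.mp h1 with h | h <;> rcases mul_neg_iff.mp h2 with h' | h'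
  · linarith [h.2, h'.1]
  · exact mul_pos h.1 h'.2
  · exact mul_pos_of_neg_of_neg h.1 h'.2
  · linarith [h.2, h'.1]

lemma opp_same {x y z : ℝ} (h1 : x * y < 0) (h2 : 0 < y * z) : x * z < 0 := by
  rcases mul_neg_iff.mp h1 with h | h <;> rcases mul_pos_iff.mp h2 with h' | h'
  · linarith [h.2, h'.1]
  · exact mul_neg_of_pos_of_neg h.1 h'.2
  · exact mul_neg_of_neg_of_pos h.1 h'.2
  · linarith [h.2, h'.1]

lemma same_same {x y z : ℝ} (h1 : 0 < x * y) (h2 : 0 < y * z) : 0 < x * z := by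
  rcases mul_pos_iff.mp h1 with h | h <;> rcases mul_pos_iff.mp h2 with h' | h'
  · exact mul_pos h.1 h'.2
  · linarith [h.2, h'.1]
  · linarith [h.2, h'.1]
  · exact mul_pos_of_neg_of_neg h.1 h'.2

lemma same_opp {x y z : ℝ} (h1 : 0 < x * y) (h2 : y * z < 0) : x * z < 0 := by
  rw [mul_comm] at h1 h2 ⊢
  exact opp_same h2 h1

lemma opp_comm {x y : ℝ} (h : x * y < 0) : y * x < 0 := by rwa [mul_comm]

lemma same_comm {x y : ℝ} (h : 0 < x * y) : 0 < y * x := by rwa [mul_comm]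

lemma left_ne_zero_of_opp {x y : ℝ} (h : x * y < 0) : x ≠ 0 := left_ne_zero_of_mul h.ne

lemma right_ne_zero_of_opp {x y : ℝ} (h : x * y < 0) : y ≠ 0 := right_ne_zero_of_mul h.ne

namespace TBA

variable {Δ : TBA}

/-! ### Vertices and blocking segments -/

lemma exists_other {s : Set Pt} {v : Pt} (hv : Δ.IsVertex v) :
    ∃ s' ∈ Δ.Sbar, s' ≠ s ∧ v ∈ s' := by
  obtain ⟨s₁, h1, s₂, h2, h12, hv1, hv2⟩ := hv
  by_cases h : s₁ = s
  · exact ⟨s₂, h2, fun h' => h12 (h.trans h'.symm), hv2⟩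
  · exact ⟨s₁, h1, h, hv1⟩

lemma exists_block {s m : Set Pt} (hs : s ∈ Δ.Sbar) (hm : m ∈ Δ.Sbar) (hsm : s ≠ m)
    (hp : (∀ i, s ≠ Δ.edge i) ∨ ∀ i, m ≠ Δ.edge i) {x : Pt} (hxs : x ∈ s) (hxm : x ∈ m) :
    ∃ b ∈ Δ.B, x ∈ b := by
  obtain ⟨b, hb, -⟩ := Δ.block_exists s hs m hm hsm (by
    rintro ⟨h1, h2⟩
    obtain ⟨i, hi⟩ := Δ.mem_triEdges.mp h1
    obtain ⟨j, hj⟩ := Δ.mem_triEdges.mp h2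
    rcases hp with h | h
    · exact h i hi
    · exact h j hj) x hxs hxm
  exact ⟨b, hb⟩

lemma block_eq {x : Pt} (hx : Δ.IsVertex x) {b b' : Set Pt} (hb : b ∈ Δ.B) (hb' : b' ∈ Δ.B)
    (h : x ∈ b) (h' : x ∈ b') : b = b' := by
  obtain ⟨s, hs, m, hm, hsm, hxs, hxm⟩ := hx
  exact Δ.block_unique s hs m hm hsm x hxs hxm b hb b' hb' h h'

lemma exists_cross {c : Set Pt} (hc : c ∈ Δ.Sbar ∪ Δ.B) {x y : Pt} (hx : x ∈ Δ.tri)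
    (hy : y ∈ Δ.tri) (h : Δ.fn c x * Δ.fn c y < 0) : ∃ z ∈ openSegment ℝ x y, z ∈ c := by
  obtain ⟨z, hz, h0⟩ := exists_zero_of_mul_neg _ h
  exact ⟨z, hz, (mem_chord hc).mpr ⟨Δ.mem_tri_of_mem_openSegment hz hx hy, h0⟩⟩

/-- A line meeting the side `o(x,y)` properly meets one of the two others, or the corner `z`. -/
lemma cross_cases {c : Set Pt} (hc : c ∈ Δ.Sbar ∪ Δ.B) {x y z : Pt} (hx : x ∈ Δ.tri)
    (hy : y ∈ Δ.tri) (hz : z ∈ Δ.tri) (h : Δ.fn c x * Δ.fn c y < 0) (hzc : z ∉ c) :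
    (∃ w ∈ openSegment ℝ x z, w ∈ c) ∨ ∃ w ∈ openSegment ℝ y z, w ∈ c := by
  rcases lt_or_gt_of_ne (mul_ne_zero (left_ne_zero_of_opp h) (fn_ne hc hz hzc)) with h1 | h1
  · exact Or.inl (exists_cross hc hx hz h1)
  · exact Or.inr (exists_cross hc hy hz (opp_same (opp_comm h) h1))

variable (Δ) in
/-- The corner `A` of the angle `B A C` is internally blocked. -/
def Blk (A B C : Pt) : Prop :=
  ∃ b ∈ Δ.B, A ∈ b ∧ Δ.fn b B * Δ.fn b C < 0

lemma Blk.symm {A B C : Pt} (h : Δ.Blk A B C) : Δ.Blk A C B := by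
  obtain ⟨b, hb, hA, h⟩ := h
  exact ⟨b, hb, hA, opp_comm h⟩

lemma blk_comm {A B C : Pt} : Δ.Blk A B C ↔ Δ.Blk A C B := ⟨Blk.symm, Blk.symm⟩

lemma blk_congr_left {A B C P : Pt} (hP : P ∈ openSegment ℝ A B) :
    Δ.Blk A P C ↔ Δ.Blk A B C := by
  constructor
  · rintro ⟨b, hb, hA, h⟩
    refine ⟨b, hb, hA, ?_⟩
    have h0 := fn_zero (B_chord hb) hA
    have hB : Δ.fn b B ≠ 0 := fun hB => left_ne_zero_of_opp h (zero_of_ends _ hP h0 hB)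
    exact same_opp (same_comm (mul_pos_of_zero_left _ hP h0 hB)) h
  · rintro ⟨b, hb, hA, h⟩
    refine ⟨b, hb, hA, ?_⟩
    have h0 := fn_zero (B_chord hb) hA
    exact same_opp (mul_pos_of_zero_left _ hP h0 (left_ne_zero_of_opp h)) h

lemma blk_congr_right {A B C Q : Pt} (hQ : Q ∈ openSegment ℝ A C) :
    Δ.Blk A B Q ↔ Δ.Blk A B C := by
  rw [blk_comm, blk_congr_left hQ, blk_comm]

lemma blk_supplement {s m : Set Pt} (hs : s ∈ Δ.Sbar) (hm : m ∈ Δ.Sbar) (hsm : s ≠ m)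
    (hp : (∀ i, s ≠ Δ.edge i) ∨ ∀ i, m ≠ Δ.edge i) {U V W p : Pt} (hUW : U ≠ W)
    (hU : U ∈ s) (hW : W ∈ s) (hV : V ∈ openSegment ℝ U W) (hVm : V ∈ m) (hpm : p ∈ m)
    (hpV : p ≠ V) : Δ.Blk V U p ↔ ¬ Δ.Blk V W p := by
  have hVs := openSegment_subset_chord (Sbar_chord hs) hU hW hV
  have hvert : Δ.IsVertex V := ⟨s, hs, m, hm, hsm, hVs, hVm⟩
  have hUV : U ≠ V := (ne_left_of_mem_openSegment hV hUW).symm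
  obtain ⟨b, hb, hVb⟩ := exists_block hs hm hsm hp hVs hVm
  have hbU : Δ.fn b U ≠ 0 := fn_ne (B_chord hb) (chord_tri (Sbar_chord hs) hU) fun h =>
    hUV (block_unique_point hs hb hU hVs h hVb)
  have hbp : Δ.fn b p ≠ 0 := fn_ne (B_chord hb) (chord_tri (Sbar_chord hm) hpm) fun h =>
    hpV (block_unique_point hm hb hpm hVm h hVb)
  have hneg := mul_neg_of_zero_between _ hV (fn_zero (B_chord hb) hVb) hbU
  constructor
  · rintro ⟨b₁, hb₁, h1, h2⟩ ⟨b₂, hb₂, h3, h4⟩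
    obtain rfl := block_eq hvert hb hb₁ hVb h1
    obtain rfl := block_eq hvert hb hb₂ hVb h3
    linarith [opp_opp hneg h4]
  · intro h
    refine ⟨b, hb, hVb, ?_⟩
    rcases lt_or_gt_of_ne (mul_ne_zero hbU hbp) with h1 | h1
    · exact h1
    · exact absurd ⟨b, hb, hVb, opp_same (opp_comm hneg) h1⟩ h

lemma not_blk_of_minimal {a : Set Pt} (ha : a ∈ Δ.Sbar) {A B C : Pt} (hB : B ∈ a) (hC : C ∈ a)
    (h : Δ.MinimalSeg B C) : ¬ Δ.Blk A B C := by
  rintro ⟨b, hb, hA, hn⟩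
  obtain ⟨z, hz, hzb⟩ := exists_cross (B_chord hb) (chord_tri (Sbar_chord ha) hB)
    (chord_tri (Sbar_chord ha) hC) hn
  exact h z hz (isVertex_of_block ha hb (openSegment_subset_chord (Sbar_chord ha) hB hC hz) hzb)

lemma MinimalSeg.symm {x y : Pt} (h : Δ.MinimalSeg x y) : Δ.MinimalSeg y x :=
  fun p hp => h p (mem_openSegment_comm.mp hp)

/-! ### Triangles of initial segments -/

variable (Δ) in
/-- A triangle `A B C` whose sides lie on the initial segments `a ∌ A`, `b ∌ B`, `c ∌ C`. -/
structure IsTri (a b c : Set Pt) (A B C : Pt) : Prop where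
  ha : a ∈ Δ.Sbar
  hb : b ∈ Δ.Sbar
  hc : c ∈ Δ.Sbar
  hab : a ≠ b
  hac : a ≠ c
  hbc : b ≠ c
  Ba : B ∈ a
  Ca : C ∈ a
  Ab : A ∈ b
  Cb : C ∈ b
  Ac : A ∈ c
  Bc : B ∈ c

variable (Δ) in
/-- `g` cuts off the corner `A` of the triangle `A B C`, at `P ∈ AB` and `Q ∈ AC`. -/
structure Cut (A B C : Pt) (g : Set Pt) (P Q : Pt) : Prop where
  hg : g ∈ Δ.Sbar
  Pg : P ∈ g
  Qg : Q ∈ g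
  hP : P ∈ openSegment ℝ A B
  hQ : Q ∈ openSegment ℝ A C

variable (Δ) in
/-- No initial segment cuts off the corner `A` of the triangle `A B C`. -/
def NoCut (A B C : Pt) : Prop := ∀ g P Q, ¬ Δ.Cut A B C g P Q

lemma Cut.swap {A B C P Q : Pt} {g : Set Pt} (h : Δ.Cut A B C g P Q) : Δ.Cut A C B g Q P :=
  ⟨h.hg, h.Qg, h.Pg, h.hQ, h.hP⟩

lemma NoCut.swap {A B C : Pt} (h : Δ.NoCut A B C) : Δ.NoCut A C B :=
  fun g P Q hg => h g Q P hg.swap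

namespace IsTri

variable {a b c : Set Pt} {A B C : Pt}

lemma rot (t : Δ.IsTri a b c A B C) : Δ.IsTri b c a B C A :=
  ⟨t.hb, t.hc, t.ha, t.hbc, t.hab.symm, t.hac.symm, t.Cb, t.Ab, t.Bc, t.Ac, t.Ba, t.Ca⟩

end IsTri

end TBA

namespace TBA

variable {Δ : TBA} {a b c : Set Pt} {A B C : Pt}

namespace IsTri

lemma swap (t : Δ.IsTri a b c A B C) : Δ.IsTri a c b A C B :=
  ⟨t.ha, t.hc, t.hb, t.hac, t.hab, t.hbc.symm, t.Ca, t.Ba, t.Ac, t.Bc, t.Ab, t.Cb⟩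

lemma swapAB (t : Δ.IsTri a b c A B C) : Δ.IsTri b a c B A C := t.swap.rot.rot

lemma nA (t : Δ.IsTri a b c A B C) : A ∉ a := fun h =>
  (no_three t.hb t.hc t.ha t.Ab t.Ac h t.hbc).elim t.hab t.hac

lemma nB (t : Δ.IsTri a b c A B C) : B ∉ b := t.rot.nA

lemma nC (t : Δ.IsTri a b c A B C) : C ∉ c := t.rot.rot.nA

lemma hAB (t : Δ.IsTri a b c A B C) : A ≠ B := fun h => t.nA (h ▸ t.Ba)

lemma hAC (t : Δ.IsTri a b c A B C) : A ≠ C := t.swap.hAB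

lemma hBC (t : Δ.IsTri a b c A B C) : B ≠ C := t.rot.hAB

lemma tA (t : Δ.IsTri a b c A B C) : A ∈ Δ.tri := chord_tri (Sbar_chord t.hb) t.Ab

lemma tB (t : Δ.IsTri a b c A B C) : B ∈ Δ.tri := t.rot.tA

lemma tC (t : Δ.IsTri a b c A B C) : C ∈ Δ.tri := t.rot.rot.tA

lemma fA (t : Δ.IsTri a b c A B C) : Δ.fn a A ≠ 0 := fn_ne (Sbar_chord t.ha) t.tA t.nA

lemma mem_c (t : Δ.IsTri a b c A B C) {P : Pt} (hP : P ∈ openSegment ℝ A B) : P ∈ c :=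
  openSegment_subset_chord (Sbar_chord t.hc) t.Ac t.Bc hP

lemma mem_b (t : Δ.IsTri a b c A B C) {P : Pt} (hP : P ∈ openSegment ℝ A C) : P ∈ b :=
  t.swap.mem_c hP

lemma mem_a (t : Δ.IsTri a b c A B C) {P : Pt} (hP : P ∈ openSegment ℝ B C) : P ∈ a :=
  t.rot.mem_c hP

/-- A segment meeting the interior of a side, other than that side, misses its ends. -/
lemma sep (t : Δ.IsTri a b c A B C) {g : Set Pt} {P : Pt} (hg : g ∈ Δ.Sbar) (hgc : g ≠ c)
    (hP : P ∈ openSegment ℝ A B) (hPg : P ∈ g) : Δ.fn g A * Δ.fn g B < 0 := by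
  refine mul_neg_of_zero_between _ hP (fn_zero (Sbar_chord hg) hPg)
    (fn_ne (Sbar_chord hg) t.tA fun h => ?_)
  exact ne_left_of_mem_openSegment hP t.hAB (Sbar_unique hg t.hc hgc hPg h (t.mem_c hP) t.Ac)

lemma ne_of_sep (t : Δ.IsTri a b c A B C) {g : Set Pt} (h : Δ.fn g A * Δ.fn g B < 0) :
    g ≠ a ∧ g ≠ b ∧ g ≠ c := by
  refine ⟨?_, ?_, ?_⟩ <;> rintro rfl
  · exact right_ne_zero_of_opp h (fn_zero (Sbar_chord t.ha) t.Ba)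
  · exact left_ne_zero_of_opp h (fn_zero (Sbar_chord t.hb) t.Ab)
  · exact left_ne_zero_of_opp h (fn_zero (Sbar_chord t.hc) t.Ac)

lemma pasch (t : Δ.IsTri a b c A B C) {g : Set Pt} {P : Pt} (hg : g ∈ Δ.Sbar) (hgc : g ≠ c)
    (hP : P ∈ openSegment ℝ A B) (hPg : P ∈ g) :
    (∃ Q, Δ.Cut A B C g P Q) ∨ ∃ Q, Δ.Cut B A C g P Q := by
  have hs := t.sep hg hgc hP hPg
  have hn := t.ne_of_sep hs
  have hC : C ∉ g := fun h => (no_three t.ha t.hb hg t.Ca t.Cb h t.hab).elim hn.1 hn.2.1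
  rcases cross_cases (Sbar_chord hg) t.tA t.tB t.tC hs hC with ⟨Q, h1, h2⟩ | ⟨Q, h1, h2⟩
  · exact Or.inl ⟨Q, hg, hPg, h2, hP, h1⟩
  · exact Or.inr ⟨Q, hg, hPg, h2, mem_openSegment_comm.mp hP, h1⟩

lemma cut_of_vertex (t : Δ.IsTri a b c A B C) {P : Pt} (hv : Δ.IsVertex P)
    (hP : P ∈ openSegment ℝ A B) :
    ∃ g, g ≠ c ∧ ((∃ Q, Δ.Cut A B C g P Q) ∨ ∃ Q, Δ.Cut B A C g P Q) := by
  obtain ⟨g, hg, hgc, hPg⟩ := exists_other (s := c) hv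
  exact ⟨g, hgc, t.pasch hg hgc hP hPg⟩

end IsTri

namespace Cut

variable {g : Set Pt} {P Q : Pt}

lemma ne_c (k : Δ.Cut A B C g P Q) (t : Δ.IsTri a b c A B C) : g ≠ c := by
  rintro rfl
  exact ne_left_of_mem_openSegment k.hQ t.hAC
    (Sbar_unique t.hb t.hc t.hbc (t.mem_b k.hQ) t.Ab k.Qg t.Ac)

lemma sepB (k : Δ.Cut A B C g P Q) (t : Δ.IsTri a b c A B C) : Δ.fn g A * Δ.fn g B < 0 :=
  t.sep k.hg (k.ne_c t) k.hP k.Pg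

lemma sepC (k : Δ.Cut A B C g P Q) (t : Δ.IsTri a b c A B C) : Δ.fn g A * Δ.fn g C < 0 :=
  k.swap.sepB t.swap

lemma proper (k : Δ.Cut A B C g P Q) (t : Δ.IsTri a b c A B C) (i : Fin 3) : g ≠ Δ.edge i :=
  not_edge_of_mul_neg k.hg t.tA t.tB (k.sepB t) i

/-- The triangle cut off at `A`. -/
lemma tri (k : Δ.Cut A B C g P Q) (t : Δ.IsTri a b c A B C) : Δ.IsTri g b c A P Q :=
  ⟨k.hg, t.hb, t.hc, (t.ne_of_sep (k.sepB t)).2.1, (t.ne_of_sep (k.sepB t)).2.2, t.hbc, k.Pg, k.Qg,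
    t.Ab, t.mem_b k.hQ, t.Ac, t.mem_c k.hP⟩

lemma blk (k : Δ.Cut A B C g P Q) : Δ.Blk A P Q ↔ Δ.Blk A B C := by
  rw [blk_congr_left k.hP, blk_congr_right k.hQ]

lemma blk_P (k : Δ.Cut A B C g P Q) (t : Δ.IsTri a b c A B C) :
    Δ.Blk P A Q ↔ ¬ Δ.Blk P B Q :=
  blk_supplement t.hc k.hg (k.ne_c t).symm (Or.inr (k.proper t)) t.hAB t.Ac t.Bc k.hP k.Pg k.Qg
    (k.tri t).hBC.symm

/-- Extending a cut of a smaller triangle cut off at the same corner. -/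
lemma extend {g' : Set Pt} {P' Q' : Pt} (k : Δ.Cut A B C g P Q) (k' : Δ.Cut A P Q g' P' Q') :
    Δ.Cut A B C g' P' Q' :=
  ⟨k'.hg, k'.Pg, k'.Qg, openSegment_trans k'.hP k.hP, openSegment_trans k'.hQ k.hQ⟩

lemma crossing {h : Set Pt} {P' Q' : Pt} (k : Δ.Cut A B C g P Q) (k' : Δ.Cut A B C h P' Q')
    (t : Δ.IsTri a b c A B C) (hP : P' ∈ openSegment ℝ A P) (hQ : Q ∈ openSegment ℝ A Q') :
    ∃ p ∈ openSegment ℝ P Q, p ∈ openSegment ℝ P' Q' ∧ p ∈ g ∧ p ∈ h := by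
  have tr := k.tri t
  have tr' := k'.tri t
  have hgA := (k.tri t).fA
  have hhA := (k'.tri t).fA
  have e1 : Δ.fn h A * Δ.fn h P < 0 :=
    mul_neg_of_zero_between _ hP (fn_zero (Sbar_chord k'.hg) k'.Pg) hhA
  have e2 : 0 < Δ.fn h Q * Δ.fn h A :=
    mul_pos_of_zero_right _ hQ (fn_zero (Sbar_chord k'.hg) k'.Qg) hhA
  have e3 : Δ.fn g A * Δ.fn g Q' < 0 :=
    mul_neg_of_zero_between _ hQ (fn_zero (Sbar_chord k.hg) k.Qg) hgA
  have e4 : 0 < Δ.fn g P' * Δ.fn g A :=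
    mul_pos_of_zero_right _ hP (fn_zero (Sbar_chord k.hg) k.Pg) hgA
  obtain ⟨p, hp, hph⟩ := exists_cross (Sbar_chord k'.hg) tr.tB tr.tC
    (opp_comm (same_opp e2 e1))
  obtain ⟨q, hq, hqg⟩ := exists_cross (Sbar_chord k.hg) tr'.tB tr'.tC (same_opp e4 e3)
  have hgh : g ≠ h := by
    rintro rfl; exact right_ne_zero_of_opp e1 (fn_zero (Sbar_chord k.hg) k.Pg)
  have hpg := tr.mem_a hp
  obtain rfl := Sbar_unique k.hg k'.hg hgh hpg hqg hph (tr'.mem_a hq)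
  exact ⟨p, hp, hq, hpg, hph⟩

end Cut

/-! ### The number of vertices in a triangle -/

variable (Δ) in
/-- The number of vertices of the arrangement in the triangle `A B C`. -/
def size (A B C : Pt) : ℕ := {x | Δ.IsVertex x ∧ x ∈ convexHull ℝ {A, B, C}}.ncard

lemma size_swap (A B C : Pt) : Δ.size A B C = Δ.size A C B := by
  rw [size, size, Set.pair_comm]

lemma size_rot (A B C : Pt) : Δ.size A B C = Δ.size B C A := by
  rw [size, size, Set.insert_comm, Set.pair_comm A C]

lemma size_cut {g : Set Pt} {P Q : Pt} (t : Δ.IsTri a b c A B C) (k : Δ.Cut A B C g P Q) :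
    Δ.size A P Q < Δ.size A B C := by
  refine ncard_lt_ncard ⟨fun x ⟨h1, h2⟩ => ⟨h1, ?_⟩, fun h => ?_⟩
    (finite_vertices.subset fun x hx => hx.1)
  · refine convexHull_min ?_ (convex_convexHull ℝ _) h2
    have hA : A ∈ convexHull ℝ {A, B, C} := subset_convexHull ℝ _ (by simp)
    have hB : B ∈ convexHull ℝ {A, B, C} := subset_convexHull ℝ _ (by simp)
    have hC : C ∈ convexHull ℝ {A, B, C} := subset_convexHull ℝ _ (by simp)
    have hcv := convex_convexHull ℝ {A, B, C}
    rintro y (rfl | rfl | rfl)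
    · exact hA
    · exact hcv.segment_subset hA hB (openSegment_subset_segment _ _ _ k.hP)
    · exact hcv.segment_subset hA hC (openSegment_subset_segment _ _ _ k.hQ)
  · have hB := h ⟨⟨a, t.ha, c, t.hc, t.hac, t.Ba, t.Bc⟩, subset_convexHull ℝ _ (by simp)⟩
    have hcv : Convex ℝ {x | 0 ≤ Δ.fn g A * Δ.fn g x} := by
      refine convex_iff_openSegment_subset.mpr fun x hx y hy z hz => ?_
      obtain ⟨s, h0, h1, e⟩ := affine_openSegment (Δ.fn g) hz
      have hx' : 0 ≤ Δ.fn g A * Δ.fn g x := hx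
      have hy' : 0 ≤ Δ.fn g A * Δ.fn g y := hy
      change 0 ≤ Δ.fn g A * Δ.fn g z
      rw [e]
      nlinarith [mul_nonneg (sub_nonneg.mpr h1.le) hx', mul_nonneg h0.le hy']
    have hsub : ({A, P, Q} : Set Pt) ⊆ {x | 0 ≤ Δ.fn g A * Δ.fn g x} := by
      rintro y (rfl | rfl | rfl)
      · exact mul_self_nonneg (Δ.fn g y)
      · simp [fn_zero (Sbar_chord k.hg) k.Pg]
      · simp [fn_zero (Sbar_chord k.hg) k.Qg]
    have hB' : 0 ≤ Δ.fn g A * Δ.fn g B := convexHull_min hsub hcv hB.2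
    linarith [k.sepB t]

end TBA

/-! ### Parity -/

lemma even_ncard_of_pairing {α : Type*} {V : Set α} (hV : V.Finite) (R : α → α → Prop)
    (hR : ∀ x y, R x y → R y x) (h : ∀ x ∈ V, ∃! y, y ∈ V ∧ y ≠ x ∧ R x y) : Even V.ncard := by
  classical
  choose! f hf hu using h
  have h1 : ∑ x ∈ hV.toFinset, (1 : ZMod 2) = 0 := by
    refine Finset.sum_involution (fun x _ => f x) (fun _ _ => by decide) ?_ ?_ ?_
    · intro x hx _
      exact (hf x (hV.mem_toFinset.mp hx)).2.1
    · intro x hx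
      exact hV.mem_toFinset.mpr (hf x (hV.mem_toFinset.mp hx)).1
    · intro x hx
      have hx' := hV.mem_toFinset.mp hx
      obtain ⟨h1, h2, h3⟩ := hf x hx'
      exact (hu (f x) h1 x ⟨hx', h2.symm, hR _ _ h3⟩).symm
  rw [Set.ncard_eq_toFinset_card V hV]
  simp only [Finset.sum_const, nsmul_eq_mul, mul_one] at h1
  exact (ZMod.natCast_eq_zero_iff_even).mp h1

namespace TBA

variable {Δ : TBA} {a b c : Set Pt} {A B C : Pt}

/-- `x` lies in the interior of a side of the triangle `A B C`. -/
def OnSides (A B C x : Pt) : Prop :=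
  x ∈ openSegment ℝ A B ∨ x ∈ openSegment ℝ B C ∨ x ∈ openSegment ℝ C A

lemma onSides_rot {x : Pt} : OnSides B C A x ↔ OnSides A B C x := by
  unfold OnSides; tauto

lemma onSides_swap {x : Pt} : OnSides B A C x ↔ OnSides A B C x := by
  unfold OnSides
  rw [openSegment_symm ℝ B A, openSegment_symm ℝ A C, openSegment_symm ℝ C B]; tauto

variable (Δ) in
/-- `x` is an internally blocked corner of the triangle `A B C`. -/
def BlockedCorner (A B C x : Pt) : Prop :=
  (x = A ∧ Δ.Blk A B C) ∨ (x = B ∧ Δ.Blk B C A) ∨ (x = C ∧ Δ.Blk C A B)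

lemma blockedCorner_rot {x : Pt} : Δ.BlockedCorner B C A x ↔ Δ.BlockedCorner A B C x := by
  unfold BlockedCorner; tauto

lemma blockedCorner_swap {x : Pt} : Δ.BlockedCorner B A C x ↔ Δ.BlockedCorner A B C x := by
  unfold BlockedCorner
  rw [blk_comm (A := B) (B := A), blk_comm (A := A) (B := C), blk_comm (A := C) (B := B)]; tauto

namespace IsTri

lemma pair_initial_of_cut (t : Δ.IsTri a b c A B C) {g : Set Pt} {v w : Pt}
    (k : Δ.Cut A B C g v w) {w' : Pt} (hw' : OnSides A B C w') (hne : w' ≠ v) (hg : w' ∈ g) :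
    w' = w := by
  rcases hw' with h | h | h
  · exact absurd (Sbar_unique k.hg t.hc (k.ne_c t) hg k.Pg (t.mem_c h) (t.mem_c k.hP)) hne
  · have h1 := mul_pos_between _ h (opp_opp (opp_comm (k.sepB t)) (k.sepC t))
    exact absurd (fn_zero (Sbar_chord k.hg) hg) (right_ne_zero_of_mul h1.ne')
  · exact Sbar_unique k.hg t.hb (k.swap.ne_c t.swap) hg k.Qg (t.mem_b (mem_openSegment_comm.mp h))
      (t.mem_b k.hQ)

lemma pair_initial (t : Δ.IsTri a b c A B C) {v : Pt} (hv : Δ.IsVertex v)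
    (hs : OnSides A B C v) :
    ∃! w, (Δ.IsVertex w ∧ OnSides A B C w) ∧ w ≠ v ∧
      ∃ g ∈ Δ.Sbar, g ≠ a ∧ g ≠ b ∧ g ≠ c ∧ v ∈ g ∧ w ∈ g := by
  have key : ∀ {a b c : Set Pt} {A B C : Pt}, Δ.IsTri a b c A B C → v ∈ openSegment ℝ A B →
      ∃! w, (Δ.IsVertex w ∧ OnSides A B C w) ∧ w ≠ v ∧
        ∃ g ∈ Δ.Sbar, g ≠ a ∧ g ≠ b ∧ g ≠ c ∧ v ∈ g ∧ w ∈ g := by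
    have key' : ∀ {a b c : Set Pt} {A B C w : Pt} {g : Set Pt}, Δ.IsTri a b c A B C →
        Δ.Cut A B C g v w → ∃! w, (Δ.IsVertex w ∧ OnSides A B C w) ∧ w ≠ v ∧
          ∃ g ∈ Δ.Sbar, g ≠ a ∧ g ≠ b ∧ g ≠ c ∧ v ∈ g ∧ w ∈ g := by
      intro a b c A B C w g t k
      have hn := t.ne_of_sep (k.sepB t)
      refine ⟨w, ⟨⟨⟨g, k.hg, b, t.hb, hn.2.1, k.Qg, t.mem_b k.hQ⟩,
        Or.inr (Or.inr (mem_openSegment_comm.mp k.hQ))⟩, (k.tri t).hBC.symm, g, k.hg, hn.1, hn.2.1,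
        hn.2.2, k.Pg, k.Qg⟩, ?_⟩
      rintro w' ⟨⟨-, h1⟩, h2, g', hg', -, -, hc, hv', hw'⟩
      have : g' = g := (no_three t.hc k.hg hg' (t.mem_c k.hP) k.Pg hv' hn.2.2.symm).resolve_left hc
      exact t.pair_initial_of_cut k h1 h2 (this ▸ hw')
    intro a b c A B C t h
    obtain ⟨g, -, ⟨Q, k⟩ | ⟨Q, k⟩⟩ := t.cut_of_vertex hv h
    · exact key' t k
    · have := key' t.swapAB k
      simp only [onSides_swap] at this
      refine (existsUnique_congr fun w => ?_).mp this
      simp only [and_congr_right_iff]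
      intros
      refine exists_congr fun g => ?_
      tauto
  rcases hs with h | h | h
  · exact key t h
  · have := key t.rot h
    simp only [onSides_rot] at this
    refine (existsUnique_congr fun w => ?_).mp this
    simp only [and_congr_right_iff]
    intros
    refine exists_congr fun g => ?_
    tauto
  · have := key t.rot.rot h
    refine (existsUnique_congr fun w => ?_).mp this
    rw [← onSides_rot (A := C) (B := A) (C := B)]
    simp only [and_congr_right_iff]
    intros
    refine exists_congr fun g => ?_
    tauto

/-- Where a blocking segment separating `A` from `B` and `C` can meet the triangle. -/
lemma block_points (t : Δ.IsTri a b c A B C) {β : Set Pt} (hβ : β ∈ Δ.B)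
    (hAB : Δ.fn β A * Δ.fn β B < 0) (hAC : Δ.fn β A * Δ.fn β C < 0) {v w w' : Pt} (hv : v ∈ β)
    (hvc : v ∈ c) (hw : w ∈ β) (hwb : w ∈ b)
    (hw' : (Δ.IsVertex w' ∧ OnSides A B C w') ∨ Δ.BlockedCorner A B C w') (hne : w' ≠ v)
    (hg : w' ∈ β) : w' = w := by
  have h0 := fn_zero (B_chord hβ) hg
  rcases hw' with ⟨-, h | h | h⟩ | ⟨rfl, -⟩ | ⟨rfl, -⟩ | ⟨rfl, -⟩
  · exact absurd (block_unique_point t.hc hβ (t.mem_c h) hvc hg hv) hne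
  · exact absurd h0 (right_ne_zero_of_mul (mul_pos_between _ h (opp_opp (opp_comm hAB) hAC)).ne')
  · exact block_unique_point t.hb hβ (t.mem_b (mem_openSegment_comm.mp h)) hwb hg hw
  · exact absurd h0 (left_ne_zero_of_opp hAB)
  · exact absurd h0 (right_ne_zero_of_opp hAB)
  · exact absurd h0 (right_ne_zero_of_opp hAC)

/-- Where a blocking segment through `C` can meet the triangle. -/
lemma block_points_corner (t : Δ.IsTri a b c A B C) {β : Set Pt} (hβ : β ∈ Δ.B)
    (hAB : Δ.fn β A * Δ.fn β B < 0) (hC : C ∈ β) {v w' : Pt} (hv : v ∈ β) (hvc : v ∈ c)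
    (hw' : (Δ.IsVertex w' ∧ OnSides A B C w') ∨ Δ.BlockedCorner A B C w')
    (hg : w' ∈ β) : w' = v ∨ w' = C := by
  have h0 := fn_zero (B_chord hβ) hg
  rcases hw' with ⟨-, h | h | h⟩ | ⟨rfl, -⟩ | ⟨rfl, -⟩ | ⟨rfl, -⟩
  · exact Or.inl (block_unique_point t.hc hβ (t.mem_c h) hvc hg hv)
  · exact Or.inr (block_unique_point t.ha hβ (t.mem_a h) t.Ca hg hC)
  · exact Or.inr (block_unique_point t.hb hβ (t.mem_b (mem_openSegment_comm.mp h)) t.Cb hg hC)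
  · exact absurd h0 (left_ne_zero_of_opp hAB)
  · exact absurd h0 (right_ne_zero_of_opp hAB)
  · exact Or.inr rfl

lemma pair_block_side (t : Δ.IsTri a b c A B C) {v : Pt} (hv : Δ.IsVertex v)
    (hs : v ∈ openSegment ℝ A B) :
    ∃! w, ((Δ.IsVertex w ∧ OnSides A B C w) ∨ Δ.BlockedCorner A B C w) ∧ w ≠ v ∧
      ∃ β ∈ Δ.B, v ∈ β ∧ w ∈ β := by
  obtain ⟨g, hg, hgc, hvg⟩ := exists_other (s := c) hv
  have hvc := t.mem_c hs
  obtain ⟨β, hβ, hvβ⟩ := exists_block hg t.hc hgc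
    (Or.inl fun i => not_edge_of_mul_neg hg t.tA t.tB (t.sep hg hgc hs hvg) i) hvg hvc
  have hA : Δ.fn β A ≠ 0 := fn_ne (B_chord hβ) t.tA fun h =>
    ne_left_of_mem_openSegment hs t.hAB (block_unique_point t.hc hβ hvc t.Ac hvβ h)
  have hAB := mul_neg_of_zero_between _ hs (fn_zero (B_chord hβ) hvβ) hA
  have key : ∀ {a b c : Set Pt} {A B C : Pt}, Δ.IsTri a b c A B C → v ∈ openSegment ℝ A B →
      v ∈ c → Δ.fn β A * Δ.fn β B < 0 → C ∉ β → (∃ w ∈ openSegment ℝ A C, w ∈ β) →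
      ∃! w, ((Δ.IsVertex w ∧ OnSides A B C w) ∨ Δ.BlockedCorner A B C w) ∧ w ≠ v ∧
      ∃ β ∈ Δ.B, v ∈ β ∧ w ∈ β := by
    rintro a b c A B C t hs hvc hAB hC ⟨w, hw, hwβ⟩
    have hwb := t.mem_b hw
    have hAC := mul_neg_of_zero_between _ hw (fn_zero (B_chord hβ) hwβ) (left_ne_zero_of_opp hAB)
    refine ⟨w, ⟨Or.inl ⟨isVertex_of_block t.hb hβ hwb hwβ,
      Or.inr (Or.inr (mem_openSegment_comm.mp hw))⟩, ?_, β, hβ, hvβ, hwβ⟩, ?_⟩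
    · rintro rfl
      exact ne_left_of_mem_openSegment hw t.hAC (Sbar_unique t.hb t.hc t.hbc hwb t.Ab hvc t.Ac)
    · rintro w' ⟨h1, h2, β', hβ', hv', hw'⟩
      obtain rfl := block_eq hv hβ hβ' hvβ hv'
      exact t.block_points hβ hAB hAC hvβ hvc hwβ hwb h1 h2 hw'
  by_cases hC : C ∈ β
  · refine ⟨C, ⟨Or.inr (Or.inr (Or.inr ⟨rfl, β, hβ, hC, hAB⟩)), ?_, β, hβ, hvβ, hC⟩, ?_⟩
    · rintro rfl; exact t.nC hvc
    · rintro w' ⟨h1, h2, β', hβ', hv', hw'⟩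
      obtain rfl := block_eq hv hβ hβ' hvβ hv'
      exact (t.block_points_corner hβ hAB hC hvβ hvc h1 hw').resolve_left h2
  rcases cross_cases (B_chord hβ) t.tA t.tB t.tC hAB hC with h | h
  · exact key t hs hvc hAB hC h
  · have := key t.swapAB (mem_openSegment_comm.mp hs) hvc (opp_comm hAB) hC h
    simpa only [onSides_swap, blockedCorner_swap] using this

lemma pair_block_corner (t : Δ.IsTri a b c A B C) (hC : Δ.Blk C A B) :
    ∃! w, ((Δ.IsVertex w ∧ OnSides A B C w) ∨ Δ.BlockedCorner A B C w) ∧ w ≠ C ∧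
      ∃ β ∈ Δ.B, C ∈ β ∧ w ∈ β := by
  obtain ⟨β, hβ, hCβ, hAB⟩ := hC
  obtain ⟨w, hw, hwβ⟩ := exists_cross (B_chord hβ) t.tA t.tB hAB
  have hwc := t.mem_c hw
  refine ⟨w, ⟨Or.inl ⟨isVertex_of_block t.hc hβ hwc hwβ, Or.inl hw⟩, ?_, β, hβ, hCβ, hwβ⟩, ?_⟩
  · rintro rfl; exact t.nC hwc
  · rintro w' ⟨h1, h2, β', hβ', hv', hw'⟩
    obtain rfl := block_eq ⟨a, t.ha, b, t.hb, t.hab, t.Ca, t.Cb⟩ hβ hβ' hCβ hv'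
    exact (t.block_points_corner hβ hAB hCβ hwβ hwc h1 hw').resolve_right h2

/-- The number of internally blocked corners of a triangle is even. -/
lemma parity (t : Δ.IsTri a b c A B C) : (Δ.Blk A B C ↔ Δ.Blk B C A) ↔ ¬ Δ.Blk C A B := by
  have hfin : {x | Δ.IsVertex x ∧ OnSides A B C x}.Finite :=
    finite_vertices.subset fun x hx => hx.1
  have hD : {x | Δ.BlockedCorner A B C x} ⊆ {A, B, C} := by
    rintro x (h | h | h) <;> simp [h.1]
  have hfinD : {x | Δ.BlockedCorner A B C x}.Finite := (toFinite _).subset hD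
  have e1 : Even {x | Δ.IsVertex x ∧ OnSides A B C x}.ncard :=
    even_ncard_of_pairing hfin
      (fun v w => ∃ g ∈ Δ.Sbar, g ≠ a ∧ g ≠ b ∧ g ≠ c ∧ v ∈ g ∧ w ∈ g)
      (fun x y ⟨g, h1, h2, h3, h4, h5, h6⟩ => ⟨g, h1, h2, h3, h4, h6, h5⟩)
      fun x hx => t.pair_initial hx.1 hx.2
  have e2 : Even ({x | Δ.IsVertex x ∧ OnSides A B C x} ∪ {x | Δ.BlockedCorner A B C x}).ncard := by
    refine even_ncard_of_pairing (hfin.union hfinD) (fun v w => ∃ β ∈ Δ.B, v ∈ β ∧ w ∈ β)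
      (fun x y ⟨g, h1, h2, h3⟩ => ⟨g, h1, h3, h2⟩) ?_
    have r1 := @t.rot.pair_block_side
    have r2 := @t.rot.rot.pair_block_side
    have r3 := @t.rot.pair_block_corner
    have r4 := @t.rot.rot.pair_block_corner
    have rr : ∀ x, OnSides C A B x ↔ OnSides A B C x := fun x => by rw [onSides_rot, onSides_rot]
    have rr' : ∀ x, Δ.BlockedCorner C A B x ↔ Δ.BlockedCorner A B C x := fun x => by
      rw [blockedCorner_rot, blockedCorner_rot]
    simp only [onSides_rot (A := A) (B := B) (C := C), rr,
      blockedCorner_rot (A := A) (B := B) (C := C), rr'] at r1 r2 r3 r4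
    rintro x (⟨h, h' | h' | h'⟩ | ⟨rfl, h⟩ | ⟨rfl, h⟩ | ⟨rfl, h⟩)
    · exact t.pair_block_side h h'
    · exact r1 h h'
    · exact r2 h h'
    · exact r3 h
    · exact r4 h
    · exact t.pair_block_corner h
  have hdis : Disjoint {x | Δ.IsVertex x ∧ OnSides A B C x} {x | Δ.BlockedCorner A B C x} := by
    rw [Set.disjoint_left]
    rintro x ⟨-, h⟩ h'
    have nA : ¬ OnSides A B C A := by
      rintro (h | h | h)
      · exact ne_left_of_mem_openSegment h t.hAB rfl
      · exact t.nA (t.mem_a h)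
      · exact ne_right_of_mem_openSegment h t.hAC.symm rfl
    have nB : ¬ OnSides A B C B := by
      rintro (h | h | h)
      · exact ne_right_of_mem_openSegment h t.hAB rfl
      · exact ne_left_of_mem_openSegment h t.hBC rfl
      · exact t.nB (t.mem_b (mem_openSegment_comm.mp h))
    have nC : ¬ OnSides A B C C := by
      rintro (h | h | h)
      · exact t.nC (t.mem_c h)
      · exact ne_right_of_mem_openSegment h t.hBC rfl
      · exact ne_left_of_mem_openSegment h t.hAC.symm rfl
    rcases h' with ⟨rfl, -⟩ | ⟨rfl, -⟩ | ⟨rfl, -⟩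
    · exact nA h
    · exact nB h
    · exact nC h
  rw [ncard_union_eq hdis hfin hfinD, Nat.even_add] at e2
  have e3 := e2.mp e1
  have hAB := t.hAB
  have hBC := t.hBC
  have hAC := t.hAC
  have n1 : ∀ x : Pt, {y | y = x}.ncard = 1 := fun x => ncard_singleton x
  by_cases h1 : Δ.Blk A B C <;> by_cases h2 : Δ.Blk B C A <;> by_cases h3 : Δ.Blk C A B <;>
    simp only [BlockedCorner, h1, h2, h3, and_true, and_false, or_false, false_or, n1] at e3 ⊢ <;>
    simp at e3 ⊢
  have : {x : Pt | x = A ∨ x = B ∨ x = C} = {A, B, C} := rfl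
  rw [this, ncard_insert_of_notMem (by simp [hAB, hAC]), ncard_pair hBC] at e3
  revert e3
  decide

end IsTri

end TBA

/-! ### Minimal regions -/

namespace TBA

variable {Δ : TBA}

lemma isCompact_tri : IsCompact Δ.tri := Set.Finite.isCompact_convexHull ℝ (by simp)

lemma continuous_affine (f : Pt →ᵃ[ℝ] ℝ) : Continuous f := f.continuous_of_finiteDimensional

lemma isCompact_chord {c : Set Pt} (hc : c ∈ Δ.Sbar ∪ Δ.B) : IsCompact c := by
  have : c = Δ.tri ∩ (Δ.fn c) ⁻¹' {0} := by
    ext x; rw [mem_chord hc]; rfl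
  rw [this]
  exact isCompact_tri.inter_right (isClosed_singleton.preimage (continuous_affine _))

lemma exists_mem_ne {c : Set Pt} (hc : c ∈ Δ.Sbar) (y : Pt) : ∃ z ∈ c, z ≠ y := by
  have key : ∀ u w : Pt, u ≠ w → ∃ z ∈ segment ℝ u w, z ≠ y := by
    intro u w huw
    by_cases h : u = y
    · exact ⟨w, right_mem_segment _ _ _, fun h' => huw (h.trans h'.symm)⟩
    · exact ⟨u, left_mem_segment _ _ _, h⟩
  have h12 : Δ.x1 ≠ Δ.x2 := fun h => by simpa using congrArg (Δ.cd 0) h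
  have h23 : Δ.x2 ≠ Δ.x3 := fun h => by simpa using congrArg (Δ.cd 1) h
  have h31 : Δ.x3 ≠ Δ.x1 := fun h => by simpa using congrArg (Δ.cd 2) h
  rcases hc with h | rfl | rfl | h
  · obtain ⟨u, w, huw, rfl, -⟩ := Δ.seg_wf c (Or.inl h)
    exact key u w huw
  · exact key _ _ h12
  · exact key _ _ h23
  · rw [mem_singleton_iff] at h
    exact h ▸ key _ _ h31

lemma mem_affineSpan_iff {c : Set Pt} (hc : c ∈ Δ.Sbar ∪ Δ.B) {x y z : Pt} (hxy : x ≠ y)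
    (hx : x ∈ c) (hy : y ∈ c) (hz : z ∈ Δ.tri) :
    z ∈ affineSpan ℝ ({x, y} : Set Pt) ↔ z ∈ c := by
  rw [mem_affineSpan_pair_iff_exists_lineMap_eq, mem_chord hc]
  constructor
  · rintro ⟨t, rfl⟩
    refine ⟨hz, ?_⟩
    rw [affine_lineMap, fn_zero hc hx, fn_zero hc hy]; ring
  · rintro ⟨-, h⟩
    rw [zero_iff_of_two_zeros (Δ.fn_spec hc).2.1 (exists_lineFn_ne_zero hxy) hxy (fn_zero hc hx)
      (fn_zero hc hy) (lineFn_left x y) (lineFn_right x y)] at h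
    obtain ⟨t, ht⟩ := exists_lineMap_of_lineFn_eq_zero hxy h
    exact ⟨t, ht.symm⟩

variable (Δ) in
/-- The closed cell of the arrangement around `p`. -/
def cell (p : Pt) : Set Pt := {x | ∀ i ∈ Δ.Sbar, 0 ≤ Δ.fn i p * Δ.fn i x}

variable (Δ) in
/-- The open cell of the arrangement around `p`. -/
def openCell (p : Pt) : Set Pt := {x | ∀ i ∈ Δ.Sbar, 0 < Δ.fn i p * Δ.fn i x}

lemma isClosed_cell (p : Pt) : IsClosed (Δ.cell p) := by
  have : Δ.cell p = ⋂ i ∈ Δ.Sbar, {x | 0 ≤ Δ.fn i p * Δ.fn i x} := by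
    ext x; simp [cell]
  rw [this]
  exact isClosed_biInter fun i _ =>
    isClosed_le continuous_const (continuous_const.mul (continuous_affine _))

lemma isOpen_openCell (p : Pt) : IsOpen (Δ.openCell p) := by
  have : Δ.openCell p = ⋂ i ∈ Δ.Sbar, {x | 0 < Δ.fn i p * Δ.fn i x} := by
    ext x; simp [openCell]
  rw [this]
  exact finite_Sbar.isOpen_biInter fun i _ =>
    isOpen_lt continuous_const (continuous_const.mul (continuous_affine _))

lemma openCell_subset_cell (p : Pt) : Δ.openCell p ⊆ Δ.cell p := fun _ hx i hi => (hx i hi).le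

lemma cell_openSegment {p x y z : Pt} (hx : x ∈ Δ.cell p) (hy : y ∈ Δ.cell p)
    (hz : z ∈ openSegment ℝ x y) : z ∈ Δ.cell p := by
  intro i hi
  obtain ⟨t, h0, h1, ht⟩ := affine_openSegment (Δ.fn i) hz
  rw [ht]
  nlinarith [mul_nonneg (sub_nonneg.mpr h1.le) (hx i hi), mul_nonneg h0.le (hy i hi)]

lemma convex_cell (p : Pt) : Convex ℝ (Δ.cell p) :=
  convex_iff_openSegment_subset.mpr fun _ hx _ hy _ hz => cell_openSegment hx hy hz

lemma openCell_openSegment {p x y z : Pt} (hx : x ∈ Δ.openCell p) (hy : y ∈ Δ.cell p)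
    (hz : z ∈ openSegment ℝ x y) : z ∈ Δ.openCell p := by
  intro i hi
  obtain ⟨t, h0, h1, ht⟩ := affine_openSegment (Δ.fn i) hz
  rw [ht]
  nlinarith [mul_pos (sub_pos.mpr h1) (hx i hi), mul_nonneg h0.le (hy i hi)]

lemma mem_openCell_self {p : Pt} (hp : ∀ i ∈ Δ.Sbar, Δ.fn i p ≠ 0) : p ∈ Δ.openCell p :=
  fun i hi => mul_self_pos.mpr (hp i hi)

lemma cell_subset_tri {p : Pt} (hpT : p ∈ Δ.tri) (hp : ∀ i ∈ Δ.Sbar, Δ.fn i p ≠ 0) :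
    Δ.cell p ⊆ Δ.tri := by
  intro x hx
  rw [mem_tri]
  intro i
  have h1 := hx _ (Δ.edge_mem_Sbar i)
  have h2 := hp _ (Δ.edge_mem_Sbar i)
  rw [fn_edge] at h1 h2
  have h3 := lt_of_le_of_ne (Δ.mem_tri.mp hpT i) h2.symm
  exact nonneg_of_mul_nonneg_right h1 h3

lemma openCell_eq_component {p : Pt} (hpT : p ∈ Δ.tri) (hp : ∀ i ∈ Δ.Sbar, Δ.fn i p ≠ 0) :
    connectedComponentIn (Δ.tri \ ⋃₀ Δ.Sbar) p = Δ.openCell p := by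
  have hsub : Δ.openCell p ⊆ Δ.tri \ ⋃₀ Δ.Sbar := by
    intro x hx
    refine ⟨cell_subset_tri hpT hp (openCell_subset_cell p hx), ?_⟩
    rintro ⟨i, hi, hxi⟩
    have := hx i hi
    rw [fn_zero (Sbar_chord hi) hxi] at this
    simp at this
  have hpm := mem_openCell_self hp
  refine Subset.antisymm ?_ (IsPreconnected.subset_connectedComponentIn ?_ hpm hsub)
  · intro x hx i hi
    by_contra! hn
    have hxT := connectedComponentIn_subset _ _ hx
    have hxi : Δ.fn i x ≠ 0 := fn_ne (Sbar_chord hi) hxT.1 fun h => hxT.2 ⟨i, hi, h⟩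
    have hneg := lt_of_le_of_ne hn (mul_ne_zero (hp i hi) hxi)
    have hpc := mem_connectedComponentIn (hsub hpm)
    have hz : ∃ y ∈ connectedComponentIn (Δ.tri \ ⋃₀ Δ.Sbar) p, Δ.fn i y = 0 := by
      have hc : ContinuousOn (Δ.fn i) (connectedComponentIn (Δ.tri \ ⋃₀ Δ.Sbar) p) :=
        (continuous_affine _).continuousOn
      rcases mul_neg_iff.mp hneg with h | h
      · exact isPreconnected_connectedComponentIn.intermediate_value hx hpc hc ⟨h.2.le, h.1.le⟩
      · exact isPreconnected_connectedComponentIn.intermediate_value hpc hx hc ⟨h.1.le, h.2.le⟩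
    obtain ⟨y, hy, h0⟩ := hz
    have hyT := connectedComponentIn_subset _ _ hy
    exact hyT.2 ⟨i, hi, (mem_chord (Sbar_chord hi)).mpr ⟨hyT.1, h0⟩⟩
  · refine Convex.isPreconnected (convex_iff_openSegment_subset.mpr fun x hx y hy z hz => ?_)
    exact openCell_openSegment hx (openCell_subset_cell p hy) hz

lemma isMinRegion_cell {p : Pt} (hpT : p ∈ Δ.tri) (hp : ∀ i ∈ Δ.Sbar, Δ.fn i p ≠ 0) :
    Δ.IsMinRegion (Δ.cell p) := by
  refine ⟨p, ⟨hpT, ?_⟩, ?_⟩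
  · rintro ⟨i, hi, hpi⟩
    exact hp i hi (fn_zero (Sbar_chord hi) hpi)
  · rw [openCell_eq_component hpT hp]
    refine Subset.antisymm (fun x hx => ?_)
      (closure_minimal (openCell_subset_cell p) (isClosed_cell p))
    have h1 : openSegment ℝ p x ⊆ Δ.openCell p := fun z hz =>
      openCell_openSegment (mem_openCell_self hp) hx hz
    exact closure_mono h1 (segment_subset_closure_openSegment (right_mem_segment ℝ p x))

lemma openCell_subset_interior (p : Pt) : Δ.openCell p ⊆ interior (Δ.cell p) :=
  interior_maximal (openCell_subset_cell p) (isOpen_openCell p)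

lemma mem_frontier_cell {p x : Pt} (hp : ∀ i ∈ Δ.Sbar, Δ.fn i p ≠ 0) (hx : x ∈ Δ.cell p)
    {i : Set Pt} (hi : i ∈ Δ.Sbar) (hxi : x ∈ i) : x ∈ frontier (Δ.cell p) := by
  rw [(isClosed_cell p).frontier_eq]
  refine ⟨hx, fun hint => ?_⟩
  have hc : Continuous fun t : ℝ => (AffineMap.lineMap p x t : Pt) := AffineMap.lineMap_continuous
  have h1 : ∀ᶠ t : ℝ in nhds 1, AffineMap.lineMap p x t ∈ interior (Δ.cell p) := by
    refine hc.continuousAt.eventually_mem (isOpen_interior.mem_nhds ?_)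
    rwa [AffineMap.lineMap_apply_one]
  obtain ⟨t, h2, h3⟩ := ((h1.filter_mono nhdsWithin_le_nhds).and
    (self_mem_nhdsWithin : ∀ᶠ t : ℝ in nhdsWithin 1 (Ioi 1), t ∈ Ioi 1)).exists
  have h4 := interior_subset h2 i hi
  rw [affine_lineMap, fn_zero (Sbar_chord hi) hxi] at h4
  have h5 : (1 : ℝ) < t := h3
  nlinarith [mul_self_pos.mpr (hp i hi)]

/-- Moving slightly from a point of the cell in an admissible direction stays in the cell. -/
lemma exists_perturb {p x z : Pt} (hx : x ∈ Δ.cell p) (hp : ∀ i ∈ Δ.Sbar, Δ.fn i p ≠ 0)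
    (hz : ∀ i ∈ Δ.Sbar, Δ.fn i x = 0 → 0 ≤ Δ.fn i p * Δ.fn i z) :
    ∃ t : ℝ, 0 < t ∧ t < 1 ∧ AffineMap.lineMap x z t ∈ Δ.cell p := by
  have h1 : ∀ᶠ t : ℝ in nhdsWithin 0 (Ioi 0), ∀ i ∈ Δ.Sbar,
      0 ≤ Δ.fn i p * Δ.fn i (AffineMap.lineMap x z t) := by
    rw [Filter.eventually_all_finite finite_Sbar]
    intro i hi
    by_cases h0 : Δ.fn i x = 0
    · filter_upwards [self_mem_nhdsWithin] with t ht
      have ht' : (0 : ℝ) < t := ht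
      rw [affine_lineMap, h0]
      have := mul_nonneg ht'.le (hz i hi h0)
      linarith
    · refine Filter.Eventually.filter_mono nhdsWithin_le_nhds ?_
      have hc : Continuous fun t : ℝ => Δ.fn i p * Δ.fn i (AffineMap.lineMap x z t) :=
        continuous_const.mul ((continuous_affine _).comp AffineMap.lineMap_continuous)
      have hpos : 0 < Δ.fn i p * Δ.fn i (AffineMap.lineMap x z (0 : ℝ)) := by
        rw [AffineMap.lineMap_apply_zero]
        exact lt_of_le_of_ne (hx i hi) (mul_ne_zero (hp i hi) h0).symm
      filter_upwards [hc.continuousAt.eventually_mem (isOpen_Ioi.mem_nhds hpos)] with t ht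
      exact le_of_lt ht
  obtain ⟨t, h2, h3⟩ := (h1.and (Ioo_mem_nhdsGT (show (0 : ℝ) < 1 by norm_num))).exists
  exact ⟨t, h3.1, h3.2, h2⟩

lemma exists_mem_cell_ne {p y : Pt} (hpT : p ∈ Δ.tri) (hp : ∀ i ∈ Δ.Sbar, Δ.fn i p ≠ 0)
    (hy : y ∈ Δ.cell p) {i j : Set Pt} (hi : i ∈ Δ.Sbar) (hj : j ∈ Δ.Sbar) (hij : i ≠ j)
    (hyi : y ∈ i) (hyj : y ∈ j) : ∃ z ∈ i, z ∈ Δ.cell p ∧ z ≠ y := by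
  obtain ⟨z₀, hz₀, hne⟩ := exists_mem_ne hi y
  have hjz : Δ.fn j z₀ ≠ 0 := fn_ne (Sbar_chord hj) (chord_tri (Sbar_chord hi) hz₀) fun h =>
    hne (Sbar_unique hi hj hij hz₀ hyi h hyj)
  obtain ⟨r, hr0, hr⟩ : ∃ r : ℝ, r ≠ 0 ∧ 0 ≤ Δ.fn j p * (r * Δ.fn j z₀) := by
    refine ⟨Δ.fn j p * Δ.fn j z₀, mul_ne_zero (hp j hj) hjz, ?_⟩
    nlinarith [mul_self_nonneg (Δ.fn j p * Δ.fn j z₀)]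
  have hval : ∀ (k : Set Pt), Δ.fn k y = 0 → ∀ u : ℝ,
      Δ.fn k (AffineMap.lineMap y z₀ u) = u * Δ.fn k z₀ := by
    intro k hk u
    rw [affine_lineMap, hk]; ring
  obtain ⟨t, h0, h1, ht⟩ := exists_perturb (z := AffineMap.lineMap y z₀ r) hy hp (by
    intro k hk hky
    rw [hval k hky]
    have hyk : y ∈ k := (mem_chord (Sbar_chord hk)).mpr ⟨chord_tri (Sbar_chord hi) hyi, hky⟩
    rcases no_three hi hj hk hyi hyj hyk hij with rfl | rfl
    · rw [fn_zero (Sbar_chord hk) hz₀]; simp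
    · exact hr)
  rw [lineMap_scale] at ht
  have hi0 := fn_zero (Sbar_chord hi) hyi
  refine ⟨_, (mem_chord (Sbar_chord hi)).mpr ⟨cell_subset_tri hpT hp ht, ?_⟩, ht, fun h => ?_⟩
  · rw [hval i hi0, fn_zero (Sbar_chord hi) hz₀]; simp
  · have h2 := hval j (fn_zero (Sbar_chord hj) hyj) (t * r)
    rw [h, fn_zero (Sbar_chord hj) hyj] at h2
    exact mul_ne_zero (mul_ne_zero h0.ne' hr0) hjz h2.symm

lemma segment_subset_frontier {p y z : Pt} (hp : ∀ i ∈ Δ.Sbar, Δ.fn i p ≠ 0)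
    (hy : y ∈ Δ.cell p) (hz : z ∈ Δ.cell p) {i : Set Pt} (hi : i ∈ Δ.Sbar) (hyi : y ∈ i)
    (hzi : z ∈ i) : segment ℝ y z ⊆ i ∩ frontier (Δ.cell p) := by
  have hcv : Convex ℝ i := convex_iff_openSegment_subset.mpr fun _ hx _ hy _ hz =>
    openSegment_subset_chord (Sbar_chord hi) hx hy hz
  intro x hx
  have h1 := hcv.segment_subset hyi hzi hx
  exact ⟨h1, mem_frontier_cell hp ((convex_cell p).segment_subset hy hz hx) hi h1⟩

lemma isRegionVertex_cell {p y : Pt} (hpT : p ∈ Δ.tri) (hp : ∀ i ∈ Δ.Sbar, Δ.fn i p ≠ 0)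
    (hy : y ∈ Δ.cell p) (hv : Δ.IsVertex y) : Δ.IsRegionVertex (Δ.cell p) y := by
  obtain ⟨i, hi, j, hj, hij, hyi, hyj⟩ := hv
  refine ⟨hy, i, hi, j, hj, hij, hyi, hyj, ?_, ?_⟩
  · obtain ⟨z, h1, h2, h3⟩ := exists_mem_cell_ne hpT hp hy hi hj hij hyi hyj
    exact ⟨y, z, h3.symm, segment_subset_frontier hp hy h2 hi hyi h1⟩
  · obtain ⟨z, h1, h2, h3⟩ := exists_mem_cell_ne hpT hp hy hj hi hij.symm hyj hyi
    exact ⟨y, z, h3.symm, segment_subset_frontier hp hy h2 hj hyj h1⟩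

lemma consec_cell {p y z : Pt} (hpT : p ∈ Δ.tri) (hp : ∀ i ∈ Δ.Sbar, Δ.fn i p ≠ 0)
    (hy : y ∈ Δ.cell p) (hz : z ∈ Δ.cell p) (hvy : Δ.IsVertex y) (hvz : Δ.IsVertex z)
    {i : Set Pt} (hi : i ∈ Δ.Sbar) (hyi : y ∈ i) (hzi : z ∈ i) (hyz : y ≠ z) :
    Δ.Consec (Δ.cell p) y z :=
  ⟨hyz, isRegionVertex_cell hpT hp hy hvy, isRegionVertex_cell hpT hp hz hvz,
    (segment_subset_frontier hp hy hz hi hyi hzi).trans inter_subset_right⟩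

/-- The next vertex of a cell along the side `w`, coming from its vertex `U` on `s`. -/
lemma exists_next_corner {p U : Pt} (hpT : p ∈ Δ.tri) (hp : ∀ i ∈ Δ.Sbar, Δ.fn i p ≠ 0)
    (hU : U ∈ Δ.cell p) {s w : Set Pt} (hs : s ∈ Δ.Sbar) (hw : w ∈ Δ.Sbar) (hws : w ≠ s)
    (hUs : U ∈ s) (hUw : U ∈ w) : ∃ V ∈ w, V ∈ Δ.cell p ∧ V ∉ s ∧ Δ.IsVertex V := by
  have hs0 := fn_zero (Sbar_chord hs) hUs
  obtain ⟨V, ⟨hVw, hVc⟩, hmax⟩ := ((isCompact_chord (Sbar_chord hw)).inter_right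
    (isClosed_cell p)).exists_isMaxOn ⟨U, hUw, hU⟩ (f := fun x => Δ.fn s p * Δ.fn s x)
    ((continuous_const.mul (continuous_affine _)).continuousOn)
  obtain ⟨z, hzw, hzc, hzU⟩ := exists_mem_cell_ne hpT hp hU hw hs hws hUw hUs
  have hsz : Δ.fn s z ≠ 0 := fn_ne (Sbar_chord hs) (chord_tri (Sbar_chord hw) hzw) fun h =>
    hzU (Sbar_unique hw hs hws hzw hUw h hUs)
  have hz : 0 < Δ.fn s p * Δ.fn s z :=
    lt_of_le_of_ne (hzc s hs) (mul_ne_zero (hp s hs) hsz).symm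
  have hV : 0 < Δ.fn s p * Δ.fn s V := lt_of_lt_of_le hz (hmax ⟨hzw, hzc⟩)
  refine ⟨V, hVw, hVc, fun h => ?_, ?_⟩
  · rw [fn_zero (Sbar_chord hs) h] at hV; simp at hV
  · by_contra hnv
    have hw0 : ∀ u : ℝ, Δ.fn w (AffineMap.lineMap U V u) = 0 := fun u => by
      rw [affine_lineMap, fn_zero (Sbar_chord hw) hUw, fn_zero (Sbar_chord hw) hVw]; ring
    obtain ⟨t, h0, h1, ht⟩ := exists_perturb (z := AffineMap.lineMap U V (2 : ℝ)) hVc hp (by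
      intro k hk hkV
      have hVk : V ∈ k := (mem_chord (Sbar_chord hk)).mpr ⟨chord_tri (Sbar_chord hw) hVw, hkV⟩
      by_cases hkw : k = w
      · rw [hkw, hw0]; simp
      · exact absurd ⟨k, hk, w, hw, hkw, hVk, hVw⟩ hnv)
    have hmem : AffineMap.lineMap V (AffineMap.lineMap U V (2 : ℝ)) t ∈ w := by
      refine (mem_chord (Sbar_chord hw)).mpr ⟨cell_subset_tri hpT hp ht, ?_⟩
      rw [affine_lineMap, hw0, fn_zero (Sbar_chord hw) hVw]; ring
    have hle : Δ.fn s p * Δ.fn s (AffineMap.lineMap V (AffineMap.lineMap U V (2 : ℝ)) t) ≤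
      Δ.fn s p * Δ.fn s V := hmax ⟨hmem, ht⟩
    rw [affine_lineMap, affine_lineMap, hs0] at hle
    nlinarith

end TBA

/-! ### Consequences of condition (A) -/

namespace TBA

variable {Δ : TBA}

lemma MinimalSeg.same_side {s i : Set Pt} (hs : s ∈ Δ.Sbar) (hi : i ∈ Δ.Sbar) {v U : Pt}
    (hv : v ∈ s) (hU : U ∈ s) (h : Δ.MinimalSeg v U) (hvi : v ∉ i) :
    0 ≤ Δ.fn i v * Δ.fn i U := by
  by_contra! hneg
  obtain ⟨z, hz, hzi⟩ := exists_cross (Sbar_chord hi) (chord_tri (Sbar_chord hs) hv)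
    (chord_tri (Sbar_chord hs) hU) hneg
  exact h z hz ⟨i, hi, s, hs, fun h => hvi (h ▸ hv), hzi,
    openSegment_subset_chord (Sbar_chord hs) hv hU hz⟩

lemma minimalSeg_of_cell {p x y : Pt} (hp : ∀ i ∈ Δ.Sbar, Δ.fn i p ≠ 0) (hx : x ∈ Δ.cell p)
    (hy : y ∈ Δ.cell p) {w : Set Pt} (hw : w ∈ Δ.Sbar) (hxw : x ∈ w) (hyw : y ∈ w)
    (hxy : x ≠ y) : Δ.MinimalSeg x y := by
  intro z hz hzv
  obtain ⟨k, hk, hkw, hzk⟩ := exists_other (s := w) hzv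
  have hzw := openSegment_subset_chord (Sbar_chord hw) hxw hyw hz
  have hxk : Δ.fn k x ≠ 0 := fn_ne (Sbar_chord hk) (chord_tri (Sbar_chord hw) hxw) fun h =>
    ne_left_of_mem_openSegment hz hxy (Sbar_unique hk hw hkw hzk h hzw hxw)
  have hneg := mul_neg_of_zero_between (Δ.fn k) hz (fn_zero (Sbar_chord hk) hzk) hxk
  nlinarith [mul_nonneg (hx k hk) (hy k hk), mul_self_pos.mpr (hp k hk)]

/-- There is a point of `b`, in the cell at the corner `v` between `U` and `Q`. -/
lemma exists_cell_point {s m b : Set Pt} (hs : s ∈ Δ.Sbar) (hm : m ∈ Δ.Sbar) (hsm : s ≠ m)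
    (hb : b ∈ Δ.B) {v U Q X : Pt} (hvs : v ∈ s) (hvm : v ∈ m) (hUs : U ∈ s) (hQm : Q ∈ m)
    (hUv : U ≠ v) (hQv : Q ≠ v) (hvU : Δ.MinimalSeg v U) (hvQ : Δ.MinimalSeg v Q)
    (hvb : v ∈ b) (hXb : X ∈ b) (hX : X ∈ openSegment ℝ U Q) :
    ∃ p ∈ b, (∀ i ∈ Δ.Sbar, Δ.fn i p ≠ 0) ∧ v ∈ Δ.cell p ∧ U ∈ Δ.cell p ∧ Q ∈ Δ.cell p := by
  have tv := chord_tri (Sbar_chord hs) hvs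
  have tU := chord_tri (Sbar_chord hs) hUs
  have tQ := chord_tri (Sbar_chord hm) hQm
  have hUm : U ∉ m := fun h => hUv (Sbar_unique hs hm hsm hUs hvs h hvm)
  have hQs : Q ∉ s := fun h => hQv (Sbar_unique hs hm hsm h hvs hQm hvm)
  have hsX := mul_pos_of_zero_left (Δ.fn s) hX (fn_zero (Sbar_chord hs) hUs)
    (fn_ne (Sbar_chord hs) tQ hQs)
  have hmX := mul_pos_of_zero_left (Δ.fn m) (mem_openSegment_comm.mp hX)
    (fn_zero (Sbar_chord hm) hQm) (fn_ne (Sbar_chord hm) tU hUm)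
  have key : ∀ᶠ t : ℝ in nhdsWithin 0 (Ioi 0), ∀ i ∈ Δ.Sbar, v ∉ i →
      0 < Δ.fn i v * Δ.fn i (AffineMap.lineMap v X t) := by
    rw [Filter.eventually_all_finite finite_Sbar]
    intro i hi
    by_cases h0 : v ∈ i
    · exact Filter.Eventually.of_forall fun _ h => absurd h0 h
    · refine Filter.Eventually.filter_mono nhdsWithin_le_nhds ?_
      have hc : Continuous fun t : ℝ => Δ.fn i v * Δ.fn i (AffineMap.lineMap v X t) :=
        continuous_const.mul ((continuous_affine _).comp AffineMap.lineMap_continuous)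
      have hpos : 0 < Δ.fn i v * Δ.fn i (AffineMap.lineMap v X (0 : ℝ)) := by
        rw [AffineMap.lineMap_apply_zero]
        exact mul_self_pos.mpr (fn_ne (Sbar_chord hi) tv h0)
      filter_upwards [hc.continuousAt.eventually_mem (isOpen_Ioi.mem_nhds hpos)] with t ht _
      exact ht
  obtain ⟨t, h2, h0, h1⟩ := (key.and (Ioo_mem_nhdsGT (show (0 : ℝ) < 1 by norm_num))).exists
  have hval : ∀ i ∈ Δ.Sbar, v ∈ i →
      Δ.fn i (AffineMap.lineMap v X t) = t * Δ.fn i X := fun i hi hvi => by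
    rw [affine_lineMap, fn_zero (Sbar_chord hi) hvi]; ring
  have hsp : 0 < Δ.fn s (AffineMap.lineMap v X t) * Δ.fn s Q := by
    rw [hval s hs hvs, mul_assoc]; exact mul_pos h0 hsX
  have hmp : 0 < Δ.fn m (AffineMap.lineMap v X t) * Δ.fn m U := by
    rw [hval m hm hvm, mul_assoc]; exact mul_pos h0 hmX
  have hcases : ∀ i ∈ Δ.Sbar, i = s ∨ i = m ∨ v ∉ i := fun i hi => by
    by_cases hvi : v ∈ i
    · rcases no_three hs hm hi hvs hvm hvi hsm with h | h <;> simp [h]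
    · exact Or.inr (Or.inr hvi)
  have tr : ∀ {a b c : ℝ}, 0 < a * b → 0 ≤ a * c → 0 ≤ b * c := by
    intro a b c h1 h2
    by_contra! h
    nlinarith [mul_self_nonneg a, mul_nonneg h1.le h2,
      mul_neg_of_pos_of_neg (mul_self_pos.mpr (left_ne_zero_of_mul h1.ne')) h]
  refine ⟨_, openSegment_subset_chord (B_chord hb) hvb hXb (mem_openSegment_lineMap h0 h1),
    ?_, ?_, ?_, ?_⟩
  · intro i hi
    rcases hcases i hi with rfl | rfl | h
    · exact left_ne_zero_of_mul hsp.ne'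
    · exact left_ne_zero_of_mul hmp.ne'
    · exact right_ne_zero_of_mul (h2 i hi h).ne'
  · intro i hi
    by_cases h : v ∈ i
    · rw [fn_zero (Sbar_chord hi) h]; simp
    · exact (same_comm (h2 i hi h)).le
  · intro i hi
    rcases hcases i hi with rfl | rfl | h
    · rw [fn_zero (Sbar_chord hi) hUs]; simp
    · exact hmp.le
    · exact tr (h2 i hi h) (hvU.same_side hs hi hvs hUs h)
  · intro i hi
    rcases hcases i hi with rfl | rfl | h
    · exact hsp.le
    · rw [fn_zero (Sbar_chord hi) hQm]; simp
    · exact tr (h2 i hi h) (hvQ.same_side hm hi hvm hQm h)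

lemma openSegment_not_mem_block {w b : Set Pt} (hw : w ∈ Δ.Sbar) (hb : b ∈ Δ.B) {x y z : Pt}
    (hx : x ∈ w) (hy : y ∈ w) (h : Δ.MinimalSeg x y) (hz : z ∈ openSegment ℝ x y) : z ∉ b :=
  fun hzb => h z hz (isVertex_of_block hw hb
    (openSegment_subset_chord (Sbar_chord hw) hx hy hz) hzb)

/-- Around the corner `v` of a minimal region with neighbours `U` and `Q`: if the blocking
segment at `v` enters the region and meets the next side line `w` at `U`, then it passes
through the intersection of `w` and the next side line `r` at `Q`. -/
lemma Strong.concurrent (hS : Δ.Strong) {s m w r b : Set Pt} (hs : s ∈ Δ.Sbar)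
    (hm : m ∈ Δ.Sbar) (hw : w ∈ Δ.Sbar) (hr : r ∈ Δ.Sbar) (hb : b ∈ Δ.B) (hsm : s ≠ m)
    (hws : w ≠ s) (hrm : r ≠ m) {v U Q X q₀ : Pt} (hvs : v ∈ s) (hvm : v ∈ m) (hUs : U ∈ s)
    (hUw : U ∈ w) (hQm : Q ∈ m) (hQr : Q ∈ r) (hUv : U ≠ v) (hQv : Q ≠ v)
    (hvU : Δ.MinimalSeg v U) (hvQ : Δ.MinimalSeg v Q) (hvb : v ∈ b) (hXb : X ∈ b)
    (hX : X ∈ openSegment ℝ U Q) (hqb : q₀ ∈ b) (hqw : q₀ ∈ w) :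
    ∃ q ∈ b, q ∈ w ∧ q ∈ r := by
  by_cases hwr : w = r
  · exact ⟨q₀, hqb, hqw, hwr ▸ hqw⟩
  have tU := chord_tri (Sbar_chord hs) hUs
  have tQ := chord_tri (Sbar_chord hm) hQm
  have hUm : U ∉ m := fun h => hUv (Sbar_unique hs hm hsm hUs hvs h hvm)
  have hQs : Q ∉ s := fun h => hQv (Sbar_unique hs hm hsm h hvs hQm hvm)
  have hUb : U ∉ b := fun h => hUv (block_unique_point hs hb hUs hvs h hvb)
  obtain ⟨p, hpb, hp, cv, cU, cQ⟩ :=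
    exists_cell_point hs hm hsm hb hvs hvm hUs hQm hUv hQv hvU hvQ hvb hXb hX
  have hpT := chord_tri (B_chord hb) hpb
  obtain ⟨V₁, hV1w, cV1, hV1s, vV1⟩ := exists_next_corner hpT hp cU hs hw hws hUs hUw
  obtain ⟨V₅, hV5r, cV5, hV5m, vV5⟩ := exists_next_corner hpT hp cQ hm hr hrm hQm hQr
  have n1U : V₁ ≠ U := fun h => hV1s (h ▸ hUs)
  have n1v : V₁ ≠ v := fun h => hV1s (h ▸ hvs)
  have n5Q : V₅ ≠ Q := fun h => hV5m (h ▸ hQm)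
  have n5v : V₅ ≠ v := fun h => hV5m (h ▸ hvm)
  have n1Q : V₁ ≠ Q := fun h => by
    rcases no_three hm hr hw hQm hQr (h ▸ hV1w) hrm.symm with h | h
    · exact hUm (h ▸ hUw)
    · exact hwr h
  have n5U : V₅ ≠ U := fun h => by
    rcases no_three hs hw hr hUs hUw (h ▸ hV5r) hws.symm with h | h
    · exact hQs (h ▸ hQr)
    · exact hwr h.symm
  by_cases h15 : V₁ = V₅
  · subst h15
    by_cases hV : V₁ ∈ b
    · exact ⟨V₁, hV, hV1w, hV5r⟩
    have hneg : Δ.fn b U * Δ.fn b Q < 0 := mul_neg_of_zero_between _ hX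
      (fn_zero (B_chord hb) hXb) (fn_ne (B_chord hb) tU hUb)
    rcases cross_cases (B_chord hb) tU tQ (cell_subset_tri hpT hp cV1) hneg hV with
      ⟨z, hz, hzb⟩ | ⟨z, hz, hzb⟩
    · exact absurd hzb (openSegment_not_mem_block hw hb hUw hV1w
        (minimalSeg_of_cell hp cU cV1 hw hUw hV1w n1U.symm) hz)
    · exact absurd hzb (openSegment_not_mem_block hr hb hQr hV5r
        (minimalSeg_of_cell hp cQ cV5 hr hQr hV5r n5Q.symm) hz)
  · have vU : Δ.IsVertex U := ⟨s, hs, w, hw, hws.symm, hUs, hUw⟩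
    have vv : Δ.IsVertex v := ⟨s, hs, m, hm, hsm, hvs, hvm⟩
    have vQ : Δ.IsVertex Q := ⟨m, hm, r, hr, hrm.symm, hQm, hQr⟩
    have hUQ : U ≠ Q := fun h => hUm (h ▸ hQm)
    obtain ⟨q, hq, hq1, hq2⟩ := hS (Δ.cell p) (isMinRegion_cell hpT hp) V₁ U v Q V₅
      (by simp [n1U, n1v, n1Q, h15, hUv, hUQ, n5U.symm, hQv.symm, n5v.symm, n5Q.symm])
      (consec_cell hpT hp cV1 cU vV1 vU hw hV1w hUw n1U)
      (consec_cell hpT hp cU cv vU vv hs hUs hvs hUv)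
      (consec_cell hpT hp cv cQ vv vQ hm hvm hQm hQv.symm)
      (consec_cell hpT hp cQ cV5 vQ vV5 hr hQr hV5r n5Q.symm)
      b hb hvb ⟨p, hpb, openCell_subset_interior p (mem_openCell_self hp)⟩
      ⟨q₀, chord_tri (B_chord hb) hqb,
        (mem_affineSpan_iff (Sbar_chord hw) n1U hV1w hUw (chord_tri (B_chord hb) hqb)).mpr hqw,
        hqb⟩
    have tq := chord_tri (B_chord hb) hq
    exact ⟨q, hq, (mem_affineSpan_iff (Sbar_chord hw) n1U hV1w hUw tq).mp hq1,
      (mem_affineSpan_iff (Sbar_chord hr) n5Q.symm hQr hV5r tq).mp hq2⟩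

end TBA

namespace TBA

variable {Δ : TBA} {a b c : Set Pt} {A B C : Pt}

namespace Cut

variable {g : Set Pt} {P Q : Pt}

lemma isVertex_left (k : Δ.Cut A B C g P Q) (t : Δ.IsTri a b c A B C) : Δ.IsVertex P :=
  ⟨g, k.hg, c, t.hc, k.ne_c t, k.Pg, t.mem_c k.hP⟩

lemma isVertex_right (k : Δ.Cut A B C g P Q) (t : Δ.IsTri a b c A B C) : Δ.IsVertex Q :=
  k.swap.isVertex_left t.swap

end Cut

lemma IsTri.minimalSeg_third (t : Δ.IsTri a b c A B C) (h1 : Δ.MinimalSeg A C)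
    (h2 : Δ.MinimalSeg B C) : Δ.MinimalSeg A B := by
  intro z hz hv
  obtain ⟨g, -, ⟨Q, k⟩ | ⟨Q, k⟩⟩ := t.cut_of_vertex hv hz
  · exact h1 Q k.hQ (k.isVertex_right t)
  · exact h2 Q k.hQ (k.isVertex_right t.swapAB)

lemma exists_next_beyond {s : Set Pt} (hs : s ∈ Δ.Sbar) {v y : Pt} (hv : v ∈ s) (hy : y ∈ s)
    (hvy : v ≠ y) (hb : v ∉ Δ.bdry) :
    ∃ z ∈ s, Δ.IsVertex z ∧ v ∈ openSegment ℝ z y ∧ Δ.MinimalSeg v z := by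
  obtain ⟨z₀, hz₀, hvz₀, hyz⟩ := exists_vertex_beyond hs hv hy hvy hb
  have hne : v ≠ z₀ := by
    intro h
    by_cases hyz₀ : y = z₀
    · exact hvy (h.trans hyz₀.symm)
    · exact ne_right_of_mem_openSegment hyz hyz₀ h
  obtain ⟨u, hu, hvu, -, hcase, hmin⟩ := exists_next hs hv hz₀ hvz₀ hne
  refine ⟨u, hu, hvu, ?_, hmin⟩
  rcases hcase with rfl | h
  · exact mem_openSegment_comm.mp hyz
  · exact openSegment_shift (mem_openSegment_comm.mp h) (mem_openSegment_comm.mp hyz)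

lemma ne_of_between {x y z : Pt} (h : z ∈ openSegment ℝ x y) (hzy : z ≠ y) : x ≠ z := by
  rintro rfl
  by_cases hxy : x = y
  · exact hzy hxy
  · exact ne_left_of_mem_openSegment h hxy rfl

/-- Let `v P Q` be a triangle without vertices on its sides, and let `w` meet the line `vP` at
the first vertex beyond `v`. If `w` meets the line `PQ`, then `w` also meets the line `vQ` at
the first vertex beyond `v`. -/
lemma Strong.next_on_line (hS : Δ.Strong) {r m s w : Set Pt} {v P Q U R : Pt}
    (t : Δ.IsTri r m s v P Q) (hvb : v ∉ Δ.bdry) (hvP : Δ.MinimalSeg v P)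
    (hvQ : Δ.MinimalSeg v Q) (hPQ : Δ.MinimalSeg P Q) (hw : w ∈ Δ.Sbar) (hws : w ≠ s)
    (hUs : U ∈ s) (hUw : U ∈ w) (hU : v ∈ openSegment ℝ U P) (hvU : Δ.MinimalSeg v U)
    (hRr : R ∈ r) (hRw : R ∈ w) :
    ∃ Z ∈ m, Z ∈ w ∧ v ∈ openSegment ℝ Z Q ∧ Δ.MinimalSeg v Z := by
  obtain ⟨Z, hZm, hZ, hvZQ, hvZ⟩ := exists_next_beyond t.hb t.Ab t.Cb t.hAC hvb
  obtain ⟨z, hz, hzm, hZz⟩ := exists_other (s := m) hZ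
  refine ⟨Z, hZm, ?_, hvZQ, hvZ⟩
  suffices z = w from this ▸ hZz
  have hUv : U ≠ v := ne_of_between hU t.hAB
  have hZv : Z ≠ v := ne_of_between hvZQ t.hAC
  obtain ⟨β, hβ, hvβ⟩ := exists_block t.hb t.hc t.hbc
    (Or.inl fun i => proper_of_not_bdry t.Ab hvb i) t.Ab t.Ac
  have off : ∀ {s : Set Pt} {P : Pt}, s ∈ Δ.Sbar → v ∈ s → P ∈ s → P ≠ v → Δ.fn β P ≠ 0 :=
    fun hs hv hP hne => fn_ne (B_chord hβ) (chord_tri (Sbar_chord hs) hP) fun h =>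
      hne (block_unique_point hs hβ hP hv h hvβ)
  have hP0 := off t.hc t.Ac t.Bc t.hAB.symm
  have hQ0 := off t.hb t.Ab t.Cb t.hAC.symm
  have hsame : 0 < Δ.fn β P * Δ.fn β Q := by
    refine lt_of_le_of_ne ?_ (mul_ne_zero hP0 hQ0).symm
    by_contra! h
    exact not_blk_of_minimal t.ha t.Ba t.Ca hPQ ⟨β, hβ, hvβ, h⟩
  have hv0 := fn_zero (B_chord hβ) hvβ
  have hUP := mul_neg_of_zero_between _ hU hv0 (off t.hc t.Ac hUs hUv)
  have hZQ := mul_neg_of_zero_between _ hvZQ hv0 (off t.hb t.Ab hZm hZv)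
  have tU := chord_tri (Sbar_chord hw) hUw
  have tZ := chord_tri (Sbar_chord hz) hZz
  obtain ⟨X, hX, hXβ⟩ := exists_cross (B_chord hβ) tU t.tC (opp_same hUP hsame)
  obtain ⟨X', hX', hXβ'⟩ := exists_cross (B_chord hβ) t.tB tZ
    (opp_comm (opp_same hZQ (same_comm hsame)))
  have hfirst : ∃ q ∈ β, q ∈ w ∧ q ∈ r := by
    have h1 : ∀ q₀ ∈ β, q₀ ∈ w → ∃ q ∈ β, q ∈ w ∧ q ∈ r := fun q₀ h h' =>
      hS.concurrent t.hc t.hb hw t.ha hβ t.hbc.symm hws t.hab t.Ac t.Ab hUs hUw t.Cb t.Ca hUv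
        t.hAC.symm hvU hvQ hvβ hXβ hX h h'
    by_cases hRβ : R ∈ β
    · exact ⟨R, hRβ, hRw, hRr⟩
    rcases cross_cases (B_chord hβ) tU t.tC (chord_tri (Sbar_chord hw) hRw)
      (opp_same hUP hsame) hRβ with ⟨q, hq, hqβ⟩ | ⟨q, hq, hqβ⟩
    · exact h1 q hqβ (openSegment_subset_chord (Sbar_chord hw) hUw hRw hq)
    · obtain ⟨q', h1, h2, h3⟩ := hS.concurrent t.hb t.hc t.ha hw hβ t.hbc t.hab hws t.Ab t.Ac
        t.Cb t.Ca hUs hUw t.hAC.symm hUv hvQ hvU hvβ hXβ (mem_openSegment_comm.mp hX) hqβ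
        (openSegment_subset_chord (Sbar_chord t.ha) t.Ca hRr hq)
      exact ⟨q', h1, h3, h2⟩
  obtain ⟨q, hqβ, hqw, hqr⟩ := hfirst
  obtain ⟨q', hqβ', hqr', hqz'⟩ := hS.concurrent t.hc t.hb t.ha hz hβ t.hbc.symm t.hac hzm t.Ac
    t.Ab t.Bc t.Ba hZm hZz t.hAB.symm hZv hvP hvZ hvβ hXβ' hX' hqβ hqr
  have hqq := block_unique_point t.ha hβ hqr hqr' hqβ hqβ'
  subst hqq
  have hne : ∀ {s w : Set Pt} {U P : Pt}, s ∈ Δ.Sbar → s ≠ r → U ∈ s → U ∈ w → P ∈ s →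
      P ∈ r → v ≠ P → v ∈ openSegment ℝ U P → w ≠ r := by
    rintro s w U P hs hsr hUs hUw hPs hPr hvP hv rfl
    have : U = P := Sbar_unique hs t.ha hsr hUs hPs hUw hPr
    subst this
    rw [openSegment_same] at hv
    exact hvP hv
  have hwr := hne t.hc t.hac.symm hUs hUw t.Bc t.Ba t.hAB hU
  have hzr := hne t.hb t.hab.symm hZm hZz t.Cb t.Ca t.hAC hvZQ
  exact (no_three hw t.ha hz hqw hqr hqz' hwr).resolve_right hzr

/-- The forbidden configuration of four lines. -/
lemma Strong.no_adjacent_strips (hS : Δ.Strong) {c g k w : Set Pt} {P Q X W p y : Pt}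
    (hc : c ∈ Δ.Sbar) (hg : g ∈ Δ.Sbar) (hk : k ∈ Δ.Sbar) (hw : w ∈ Δ.Sbar)
    (hcg : c ≠ g) (hck : c ≠ k) (hcw : c ≠ w) (hgk : g ≠ k) (hgw : g ≠ w) (hkw : k ≠ w)
    (hgp : ∀ i, g ≠ Δ.edge i) (hPc : P ∈ c) (hPg : P ∈ g) (hXc : X ∈ c) (hXk : X ∈ k)
    (hWc : W ∈ c) (hWw : W ∈ w) (hX : X ∈ openSegment ℝ P W) (hpg : p ∈ g) (hpk : p ∈ k)
    (hyg : y ∈ g) (hyw : y ∈ w) (hp : p ∈ openSegment ℝ P y) (hQg : Q ∈ g)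
    (hy : y ∈ openSegment ℝ P Q) (mPX : Δ.MinimalSeg P X) (mPp : Δ.MinimalSeg P p)
    (mXp : Δ.MinimalSeg X p) (mpy : Δ.MinimalSeg p y) (myW : Δ.MinimalSeg y W) : False := by
  have off : ∀ {c g k : Set Pt} {x : Pt}, c ∈ Δ.Sbar → g ∈ Δ.Sbar → k ∈ Δ.Sbar → c ≠ g →
      k ≠ c → k ≠ g → x ∈ c → x ∈ k → x ∉ g := fun hc hg hk h1 h2 h3 hxc hxk hxg => by
    rcases no_three hc hg hk hxc hxg hxk h1 with h | h
    · exact h2 h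
    · exact h3 h
  have hXg : X ∉ g := off hc hg hk hcg hck.symm hgk.symm hXc hXk
  have hWg : W ∉ g := off hc hg hw hcg hcw.symm hgw.symm hWc hWw
  have hyc : y ∉ c := off hg hc hw hcg.symm hgw.symm hcw.symm hyg hyw
  have hPy : P ≠ y := fun h => hyc (h ▸ hPc)
  have hPQ : P ≠ Q := by
    rintro rfl
    rw [openSegment_same] at hy
    exact hPy hy.symm
  have t1 : Δ.IsTri c k g p P X := ⟨hc, hk, hg, hck, hcg, hgk.symm, hPc, hXc, hpk, hXk, hpg, hPg⟩
  obtain ⟨Z, hZk, hZw, hpZ, mpZ⟩ := hS.next_on_line t1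
    (not_bdry_of_proper hg hgp hPg hyg hPy hp) mPp.symm mXp.symm mPX hw hgw.symm hyg hyw
    (mem_openSegment_comm.mp hp) mpy hWc hWw
  have t2 : Δ.IsTri k g w y Z p := ⟨hk, hg, hw, hgk.symm, hkw, hgw, hZk, hpk, hyg, hpg, hyw, hZw⟩
  have tX := chord_tri (Sbar_chord hc) hXc
  have tW := chord_tri (Sbar_chord hc) hWc
  have h1 := mul_pos_of_zero_left (Δ.fn g) hX (fn_zero (Sbar_chord hg) hPg)
    (fn_ne (Sbar_chord hg) tW hWg)
  have h2 := mul_neg_of_zero_between (Δ.fn g) (mem_openSegment_comm.mp hpZ)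
    (fn_zero (Sbar_chord hg) hpg) (fn_ne (Sbar_chord hg) tX hXg)
  obtain ⟨y', hy', hyg'⟩ := exists_cross (Sbar_chord hg) tW (chord_tri (Sbar_chord hk) hZk)
    (same_opp (same_comm h1) h2)
  have hyy : y' = y := Sbar_unique hg hw hgw hyg' hyg
    (openSegment_subset_chord (Sbar_chord hw) hWw hZw hy') hyw
  subst hyy
  obtain ⟨Z', hZg, hZc, hyZ, -⟩ := hS.next_on_line t2
    (not_bdry_of_proper hg hgp hPg hQg hPQ hy) (t2.minimalSeg_third mpy.symm mpZ.symm)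
    mpy.symm mpZ.symm hc hcw hWw hWc hy' myW hXk hXc
  have : Z' = P := Sbar_unique hg hc hcg.symm hZg hPg hZc hPc
  subst this
  have h3 := openSegment_shift hp hyZ
  rw [openSegment_same] at h3
  exact t2.hAC h3

end TBA

/-! ### Crossing cuts -/

namespace TBA

variable {Δ : TBA} {a b c : Set Pt} {A B C : Pt}

variable (Δ) in
/-- No two initial segments cutting off the corner `A` cross inside the triangle `A B C`. -/
def NoCross (A B C : Pt) : Prop :=
  ∀ g P Q h P' Q', Δ.Cut A B C g P Q → Δ.Cut A B C h P' Q' → P' ∈ openSegment ℝ A P →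
    Q ∉ openSegment ℝ A Q'

variable (Δ) in
/-- No initial segment joins the side `BC` to the part of the side `AB` which is cut off at the
corner `A` by another initial segment. -/
def NoThru (A B C : Pt) : Prop :=
  ∀ g P Q k X Y, Δ.Cut A B C g P Q → k ∈ Δ.Sbar → X ∈ openSegment ℝ A P → X ∈ k →
    Y ∈ openSegment ℝ B C → Y ∉ k

namespace IsTri

lemma cut_unique_line (t : Δ.IsTri a b c A B C) {g h : Set Pt} {P Q Q' : Pt}
    (k : Δ.Cut A B C g P Q) (l : Δ.Cut A B C h P Q') : g = h :=
  ((no_three t.hc l.hg k.hg (t.mem_c k.hP) l.Pg k.Pg (l.ne_c t).symm).resolve_left (k.ne_c t))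

/-- If cuts at `A` do not cross, a vertex on `AW` lies on a cut ending between `A` and `Y`. -/
lemma cut_of_vertex_left (t : Δ.IsTri a b c A B C) (hE : Δ.NoCross A B C) (hD : Δ.NoThru B A C)
    {w : Set Pt} {W Y x : Pt} (k : Δ.Cut A B C w W Y) (hx : x ∈ openSegment ℝ A W)
    (hv : Δ.IsVertex x) : ∃ h q, Δ.Cut A B C h x q ∧ q ∈ openSegment ℝ A Y := by
  obtain ⟨h, -, ⟨q, l⟩ | ⟨q, l⟩⟩ := t.cut_of_vertex hv (openSegment_trans hx k.hP)
  · refine ⟨h, q, l, ?_⟩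
    rcases openSegment_trichotomy k.hQ l.hQ with rfl | h1 | h1
    · have := t.swap.cut_unique_line k.swap l.swap
      subst this
      have hxW := Sbar_unique l.hg t.hc (l.ne_c t) l.Pg k.Pg (t.mem_c l.hP) (t.mem_c k.hP)
      subst hxW
      exact absurd rfl (ne_right_of_mem_openSegment hx (k.tri t).hAB)
    · exact h1
    · exact absurd h1 (hE _ _ _ _ _ _ k l hx)
  · exact absurd k.Qg (hD _ _ _ _ _ _ l k.hg
      (mem_openSegment_comm.mp (openSegment_shift hx k.hP)) k.Pg k.hQ)

lemma minimalSeg_cut (t : Δ.IsTri a b c A B C) (hC : Δ.NoCut C A B) (hE : Δ.NoCross A B C)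
    (hD : Δ.NoThru B A C) {w : Set Pt} {W Y : Pt} (k : Δ.Cut A B C w W Y) :
    Δ.MinimalSeg W Y := by
  intro z hz hv
  have t' := k.tri t
  have key : ∀ {h : Set Pt} {x q : Pt}, Δ.Cut A W Y h x q → z ∈ h → False := by
    intro h x q l hzh
    have h1 := opp_opp (opp_comm (l.sepB t')) (l.sepC t')
    have h2 := t'.rot.sep l.hg (t'.ne_of_sep (l.sepB t')).1 hz hzh
    linarith
  obtain ⟨h, hhw, ⟨x, l⟩ | ⟨q, l⟩⟩ := t'.rot.cut_of_vertex hv hz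
  · have hxA := mem_openSegment_comm.mp l.hQ
    obtain ⟨h', q, l', hq⟩ := t.cut_of_vertex_left hE hD k hxA (l.isVertex_right t'.rot)
    have hhc : h ≠ c := (t'.rot.ne_of_sep (l.sepB t'.rot)).2.1
    have hh : h' = h := (no_three t.hc l.hg l'.hg (t.mem_c l'.hP) l.Qg l'.Pg
      hhc.symm).resolve_left (l'.ne_c t)
    subst hh
    exact key ⟨l.hg, l'.Pg, l'.Qg, hxA, hq⟩ l.Pg
  · have hqA := mem_openSegment_comm.mp l.hQ
    have hhb : h ≠ b := (t'.rot.swapAB.ne_of_sep (l.sepB t'.rot.swapAB)).2.1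
    obtain ⟨x, l'⟩ | ⟨x, l'⟩ := t.swap.pasch l.hg hhb (openSegment_trans hqA k.hQ) l.Qg
    · have l' := l'.swap
      rcases openSegment_trichotomy k.hP l'.hP with rfl | h1 | h1
      · exact hhw (t.cut_unique_line l' k)
      · exact key ⟨l.hg, l'.Pg, l'.Qg, h1, hqA⟩ l.Pg
      · exact hE _ _ _ _ _ _ l' k h1 hqA
    · exact hC _ _ _ l'

/-- Under the hypotheses, at most one initial segment cuts off the corner `A`. -/
lemma exists_single_cut (hS : Δ.Strong) (t : Δ.IsTri a b c A B C) (hC : Δ.NoCut C A B)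
    (hE : Δ.NoCross A B C) (hD : Δ.NoThru B A C) (hb : ∀ i, b ≠ Δ.edge i)
    {v : Pt} (hv : Δ.IsVertex v) (hvAC : v ∈ openSegment ℝ A C) :
    ∃ k X p, Δ.Cut A B C k X p ∧ Δ.MinimalSeg A X ∧ Δ.MinimalSeg A p ∧ Δ.MinimalSeg X p ∧
      Δ.MinimalSeg p C := by
  have cutAt : ∀ {p : Pt}, Δ.IsVertex p → p ∈ openSegment ℝ A C → ∃ k X, Δ.Cut A B C k X p := by
    intro p hp hpAC
    obtain ⟨k, -, ⟨X, l⟩ | ⟨X, l⟩⟩ := t.swap.cut_of_vertex hp hpAC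
    · exact ⟨k, X, l.swap⟩
    · exact absurd l (hC _ _ _)
  obtain ⟨p, hpb, hp, -, hpv, mAp⟩ := exists_next t.hb t.Ab (t.mem_b hvAC) hv
    (ne_left_of_mem_openSegment hvAC t.hAC).symm
  have hpAC : p ∈ openSegment ℝ A C := by
    rcases hpv with rfl | h
    · exact hvAC
    · exact openSegment_trans h hvAC
  obtain ⟨k, X, l⟩ := cutAt hp hpAC
  have mAX : Δ.MinimalSeg A X := by
    intro x hx hxv
    obtain ⟨h, q, l', hq⟩ := t.cut_of_vertex_left hE hD l hx hxv
    exact mAp q hq (l'.isVertex_right t)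
  have mXp := t.minimalSeg_cut hC hE hD l
  refine ⟨k, X, p, l, mAX, mAp, mXp, ?_⟩
  intro z hz hzv
  have hpC : p ≠ C := ne_right_of_mem_openSegment hpAC t.hAC
  obtain ⟨y, hyb, hy, -, hyz, mpy⟩ := exists_next t.hb hpb
    (openSegment_subset_chord (Sbar_chord t.hb) hpb t.Cb hz) hzv
    (ne_left_of_mem_openSegment hz hpC).symm
  have hypC : y ∈ openSegment ℝ p C := by
    rcases hyz with rfl | h
    · exact hz
    · exact openSegment_trans h hz
  have hpy : p ∈ openSegment ℝ A y := mem_openSegment_comm.mp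
    (openSegment_shift (mem_openSegment_comm.mp hypC) (mem_openSegment_comm.mp hpAC))
  have hyAC : y ∈ openSegment ℝ A C := mem_openSegment_comm.mp
    (openSegment_trans (mem_openSegment_comm.mp hypC) (mem_openSegment_comm.mp hpAC))
  obtain ⟨w, W, l'⟩ := cutAt hy hyAC
  have hkw : k ≠ w := by
    rintro rfl
    have := Sbar_unique l.hg t.hb (l.swap.ne_c t.swap) l.Qg l'.Qg hpb hyb
    exact ne_left_of_mem_openSegment hypC hpC this.symm
  have hXW : X ∈ openSegment ℝ A W := by
    rcases openSegment_trichotomy l.hP l'.hP with rfl | h | h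
    · exact absurd (t.cut_unique_line l l') hkw
    · exact absurd (l'.isVertex_left t) (mAX W h)
    · exact h
  exact hS.no_adjacent_strips t.hc t.hb l.hg l'.hg t.hbc.symm (l.ne_c t).symm (l'.ne_c t).symm
    (l.swap.ne_c t.swap).symm (l'.swap.ne_c t.swap).symm hkw hb t.Ac t.Ab (t.mem_c l.hP) l.Pg
    (t.mem_c l'.hP) l'.Pg hXW hpb l.Qg hyb l'.Qg hpy t.Cb hyAC mAX mAp mXp mpy
    (t.minimalSeg_cut hC hE hD l').symm

end IsTri

end TBA

/-! ### The induction -/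

namespace TBA

variable {Δ : TBA} {a b c : Set Pt} {A B C : Pt}

variable (Δ) in
/-- What internal or external blocking of the corner `A` says about the initial segments
cutting off this corner of the triangle `A B C` with sides `b ∋ A, C` and `c ∋ A, B`. -/
structure Controlled (b c : Set Pt) (A B C : Pt) : Prop where
  noThru : Δ.Blk A B C → Δ.NoThru A B C
  noCross : ¬ Δ.Blk A B C → Δ.NoCross A B C
  noCut : Δ.Blk A B C → ((∀ i, b ≠ Δ.edge i) ∨ ∀ i, c ≠ Δ.edge i) → Δ.NoCut A B C

variable (Δ) in
/-- All triangles of size less than `n` are controlled. -/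
def ControlledBelow (n : ℕ) : Prop :=
  ∀ a b c A B C, Δ.IsTri a b c A B C → Δ.size A B C < n → Δ.Controlled b c A B C

namespace IsTri

lemma noThru_of_blk (hS : Δ.Strong) (t : Δ.IsTri a b c A B C)
    (ih : Δ.ControlledBelow (Δ.size A B C)) (hA : Δ.Blk A B C) : Δ.NoThru A B C := by
  intro g P Q k X Y cg hk hX hXk hY hYk
  have t₁ := cg.tri t
  have hsize := size_cut t cg
  have hgp := cg.proper t
  have hkc : k ≠ c := by
    rintro rfl
    exact ne_left_of_mem_openSegment hY t.hBC
      (Sbar_unique t.hc t.ha t.hac.symm hYk t.Bc (t.mem_a hY) t.Ba)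
  have hYa := t.mem_a hY
  have hka : k ≠ a := by
    rintro rfl
    have hXB := openSegment_trans hX cg.hP
    exact ne_right_of_mem_openSegment hXB t.hAB
      (Sbar_unique hk t.hc t.hac hXk t.Ba (t.mem_c hXB) t.Bc)
  obtain ⟨p, l⟩ | ⟨p, l⟩ := t₁.pasch hk hkc hX hXk
  · have l' := cg.extend l
    have h1 := opp_opp (opp_comm (l'.sepB t)) (l'.sepC t)
    have h2 := t.rot.sep hk (t.ne_of_sep (l'.sepB t)).1 hY hYk
    linarith
  have hAP : Δ.Blk A P Q := cg.blk.mpr hA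
  have hPs : Δ.size P A Q < Δ.size A B C := by rwa [size_swap, ← size_rot]
  have hQs : Δ.size Q A P < Δ.size A B C := by rwa [size_rot]
  have hP : ¬ Δ.Blk P A Q := fun h =>
    (ih _ _ _ _ _ _ t₁.swapAB hPs).noCut h (Or.inl hgp) _ _ _ l
  have hQ : Δ.Blk Q A P := by
    by_contra hQ
    exact hP (blk_comm.mp ((t₁.parity.mpr hQ).mp hAP))
  have hnQ := (ih _ _ _ _ _ _ t₁.rot.rot hQs).noCut hQ (Or.inl hgp)
  obtain ⟨k₁, X₁, p₁, l₁, mPX, mPp, mXp, mpQ⟩ := t₁.swapAB.exists_single_cut hS hnQ.swap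
    ((ih _ _ _ _ _ _ t₁.swapAB hPs).noCross hP) ((ih _ _ _ _ _ _ t₁ hsize).noThru hAP) hgp
    (l.isVertex_right t₁.swapAB) l.hQ
  have hpp : p₁ = p := by
    rcases openSegment_trichotomy l₁.hQ l.hQ with h | h | h
    · exact h
    · exact absurd (l.isVertex_right t₁.swapAB) (mPp p h)
    · exact absurd (l.isVertex_right t₁.swapAB) (mpQ p (openSegment_shift h l.hQ))
  subst hpp
  have hkk : k₁ = k := t₁.swapAB.swap.cut_unique_line l₁.swap l.swap
  subst hkk
  have hXX : X₁ = X := Sbar_unique t.hc hk hkc.symm (t₁.swapAB.mem_c l₁.hP)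
    (t.mem_c (openSegment_trans hX cg.hP)) l₁.Pg hXk
  subst hXX
  have hpk := l.Qg
  have hpg := t₁.mem_a l.hQ
  have hcg := (cg.ne_c t).symm
  have hkg := l.swap.ne_c t₁.swapAB.swap
  have hXc := t₁.swapAB.mem_c l₁.hP
  obtain ⟨Z, hZk, hZb, hpZ, mpZ⟩ := hS.next_on_line
    (⟨t.hc, hk, cg.hg, hkc.symm, hcg, hkg, t₁.Bc, hXc, hpk, hXk, hpg, cg.Pg⟩ :
      Δ.IsTri c k₁ g p₁ P X₁)
    (not_bdry_of_proper cg.hg hgp cg.Pg cg.Qg t₁.hBC l₁.hQ) mPp.symm mXp.symm mPX t.hb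
    (cg.swap.ne_c t.swap).symm cg.Qg (t.mem_b cg.hQ) (mem_openSegment_comm.mp l₁.hQ) mpQ t.Ac
    t.Ab
  have tX := chord_tri (Sbar_chord hk) hXk
  have tY := chord_tri (Sbar_chord hk) hYk
  have tp := chord_tri (Sbar_chord hk) hpk
  have hXY : Δ.fn g X₁ * Δ.fn g Y < 0 := by
    have h1 : 0 < Δ.fn g X₁ * Δ.fn g A := mul_pos_of_zero_right _ hX
      (fn_zero (Sbar_chord cg.hg) cg.Pg) t₁.fA
    have h2 := same_comm (mul_pos_between (Δ.fn g) hY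
      (opp_opp (opp_comm (cg.sepB t)) (cg.sepC t)))
    exact same_opp h1 (opp_same (cg.sepB t) (same_comm h2))
  obtain ⟨p', hp', hpg'⟩ := exists_cross (Sbar_chord cg.hg) tX tY hXY
  have hpp : p' = p₁ := Sbar_unique hk cg.hg hkg
    (openSegment_subset_chord (Sbar_chord hk) hXk hYk hp') hpk hpg' hpg
  subst hpp
  have hB0 : Δ.fn b B ≠ 0 := t.swapAB.fA
  have hY0 := mul_pos_of_zero_right (Δ.fn b) hY (fn_zero (Sbar_chord t.hb) t.Cb) hB0
  have hP0 := mul_pos_of_zero_left (Δ.fn b) cg.hP (fn_zero (Sbar_chord t.hb) t.Ab) hB0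
  have hp0 := mul_pos_of_zero_right (Δ.fn b) l₁.hQ
    (fn_zero (Sbar_chord t.hb) (t.mem_b cg.hQ)) (left_ne_zero_of_mul hP0.ne')
  have hZ0 := fn_zero (Sbar_chord t.hb) hZb
  rcases openSegment_prolong hp' (mem_openSegment_comm.mp hpZ) with rfl | h | h
  · exact left_ne_zero_of_mul hY0.ne' hZ0
  · have := mul_pos_between (Δ.fn b) h (same_same hp0 (same_same hP0 (same_comm hY0)))
    rw [hZ0] at this
    simp at this
  · exact mpZ Y h ⟨k₁, hk, a, t.ha, hka, hYk, hYa⟩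

lemma noCross_of_not_blk (hS : Δ.Strong) (t : Δ.IsTri a b c A B C)
    (ih : Δ.ControlledBelow (Δ.size A B C)) (hA : ¬ Δ.Blk A B C) : Δ.NoCross A B C := by
  intro g P Q h P' Q' cg ch hP' hQ
  obtain ⟨p, hpPQ, hpPQ', hpg, hph⟩ := cg.crossing ch t hP' hQ
  have t₁ := cg.tri t
  have t₂ := ch.tri t
  have l₁ : Δ.Cut P A Q h P' p := ⟨ch.hg, ch.Pg, hph, mem_openSegment_comm.mp hP', hpPQ⟩
  have l₂ : Δ.Cut Q' A P' g Q p :=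
    ⟨cg.hg, cg.Qg, hpg, mem_openSegment_comm.mp hQ, mem_openSegment_comm.mp hpPQ'⟩
  have s₁ : Δ.size P A Q < Δ.size A B C := by
    rw [size_swap, ← size_rot]; exact size_cut t cg
  have s₂ : Δ.size Q' A P' < Δ.size A B C := by
    rw [size_rot]; exact size_cut t ch
  have hPA : ¬ Δ.Blk P A Q := fun hb =>
    (ih _ _ _ _ _ _ t₁.swapAB s₁).noCut hb (Or.inl (cg.proper t)) _ _ _ l₁
  have hQA : ¬ Δ.Blk Q' A P' := fun hb =>
    (ih _ _ _ _ _ _ t₂.rot.rot s₂).noCut hb (Or.inl (ch.proper t)) _ _ _ l₂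
  have hPA' : ¬ Δ.Blk P' Q' A := fun hb =>
    hA (ch.blk.mp ((t₂.parity.mpr hQA).mpr hb))
  have hPB : Δ.Blk P' B Q' := by
    by_contra hn
    exact hPA' (blk_comm.mp ((ch.blk_P t).mpr hn))
  have t₃ := l₁.tri t₁.swapAB
  have s₃ := (size_cut t₁.swapAB l₁).trans s₁
  have hbP' : Δ.Blk P' P p :=
    (blk_congr_left (openSegment_shift hP' cg.hP)).mpr ((blk_congr_right hpPQ').mpr hPB)
  have hbP : ¬ Δ.Blk P P' p := fun hb => hPA (l₁.blk.mp hb)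
  have hbp : Δ.Blk p P P' := by
    by_contra hn
    exact hbP ((t₃.parity.mpr hn).mpr (blk_comm.mp hbP'))
  have nP' : Δ.NoCut P' P p := (ih _ _ _ _ _ _ t₃.swapAB (by
    rwa [size_swap, ← size_rot])).noCut hbP' (Or.inl (ch.proper t))
  have np : Δ.NoCut p P P' := (ih _ _ _ _ _ _ t₃.rot.rot (by
    rwa [size_rot])).noCut hbp (Or.inl (ch.proper t))
  have mpP' : Δ.MinimalSeg p P' := by
    intro z hz hv
    obtain ⟨l, -, ⟨y, k⟩ | ⟨y, k⟩⟩ := t₃.rot.cut_of_vertex hv (mem_openSegment_comm.mp hz)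
    · exact nP'.swap _ _ _ k
    · exact np.swap _ _ _ k
  by_cases hm : Δ.MinimalSeg P p
  · exact not_blk_of_minimal t₃.hb t₃.Ab t₃.Cb hm hbP'
  obtain ⟨v, hv, hvv⟩ : ∃ v ∈ openSegment ℝ P p, Δ.IsVertex v := by
    unfold MinimalSeg at hm; push Not at hm; exact hm
  obtain ⟨k, X, q, l, mPX, mPq, mXq, mqp⟩ := t₃.exists_single_cut hS np
    ((ih _ _ _ _ _ _ t₃ s₃).noCross hbP) (fun g P₀ Q₀ _ _ _ k => absurd k (nP' g P₀ Q₀))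
    (cg.proper t) hvv hv
  obtain ⟨n1, n2, n3⟩ := t₃.ne_of_sep (l.sepB t₃)
  exact hS.no_adjacent_strips t₃.hc t₃.hb l.hg t₃.ha t₃.hbc.symm n3.symm t₃.hac.symm n2.symm
    t₃.hab.symm n1 (cg.proper t) t₃.Ac t₃.Ab (t₃.mem_c l.hP) l.Pg t₃.Bc t₃.Ba l.hP
    (t₃.mem_b l.hQ) l.Qg t₃.Cb t₃.Ca l.hQ cg.Qg hpPQ mPX mPq mXq mqp mpP'

end IsTri

end TBA

namespace TBA

variable {Δ : TBA} {a b c : Set Pt} {A B C : Pt}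

namespace IsTri

/-- If no cut at `A` contains another one, then any two cuts at `A` cross. -/
lemma cuts_cross (t : Δ.IsTri a b c A B C) (hN : ∀ g P Q, Δ.Cut A B C g P Q → Δ.NoCut A P Q)
    {g h : Set Pt} {P Q P' Q' : Pt} (k : Δ.Cut A B C g P Q) (l : Δ.Cut A B C h P' Q')
    (hP : P' ∈ openSegment ℝ A P) : Q ∈ openSegment ℝ A Q' := by
  rcases openSegment_trichotomy k.hQ l.hQ with rfl | h1 | h1
  · have := t.swap.cut_unique_line k.swap l.swap
    subst this
    exact absurd (Sbar_unique k.hg t.hc (k.ne_c t) l.Pg k.Pg (t.mem_c l.hP) (t.mem_c k.hP))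
      (ne_right_of_mem_openSegment hP (k.tri t).hAB)
  · exact absurd ⟨l.hg, l.Pg, l.Qg, hP, h1⟩ (hN _ _ _ k h P' Q')
  · exact h1

/-- There are no three pairwise crossing cuts at an internally blocked corner. -/
lemma no_crossing_triple (t : Δ.IsTri a b c A B C) (ih : Δ.ControlledBelow (Δ.size A B C))
    (hA : Δ.Blk A B C) {g₁ g₂ g₃ : Set Pt} {P₁ P₂ P₃ Q₁ Q₂ Q₃ : Pt}
    (k₁ : Δ.Cut A B C g₁ P₁ Q₁) (k₂ : Δ.Cut A B C g₂ P₂ Q₂) (k₃ : Δ.Cut A B C g₃ P₃ Q₃)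
    (hP₁ : P₁ ∈ openSegment ℝ A P₂) (hP₂ : P₂ ∈ openSegment ℝ A P₃)
    (hQ₂ : Q₂ ∈ openSegment ℝ A Q₁) (hQ₃ : Q₃ ∈ openSegment ℝ A Q₂) : False := by
  have t₂ := k₂.tri t
  have hs := size_cut t k₂
  obtain ⟨p, hp, -, -, hpg⟩ := k₂.crossing k₁ t hP₁ hQ₂
  obtain ⟨q, -, hq, hqg, -⟩ := k₃.crossing k₂ t hP₂ hQ₃
  have hP : ¬ Δ.Blk P₂ A Q₂ := fun h =>
    (ih _ _ _ _ _ _ t₂.swapAB (by rwa [size_swap, ← size_rot])).noCut h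
      (Or.inl (k₂.proper t)) g₁ P₁ p
      ⟨k₁.hg, k₁.Pg, hpg, mem_openSegment_comm.mp hP₁, hp⟩
  have hQ : ¬ Δ.Blk Q₂ A P₂ := fun h =>
    (ih _ _ _ _ _ _ t₂.rot.rot (by rwa [size_rot])).noCut h
      (Or.inl (k₂.proper t)) g₃ Q₃ q
      ⟨k₃.hg, k₃.Qg, hqg, mem_openSegment_comm.mp hQ₃, mem_openSegment_comm.mp hq⟩
  exact hP (blk_comm.mp ((t₂.parity.mpr hQ).mp (k₂.blk.mpr hA)))

/-- The outer cut of a crossing pair of cuts at an internally blocked corner meets no other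
segment before the inner one. -/
lemma eq_of_vertex_crossing (t : Δ.IsTri a b c A B C) (ih : Δ.ControlledBelow (Δ.size A B C))
    (hA : Δ.Blk A B C) (hN : ∀ g P Q, Δ.Cut A B C g P Q → Δ.NoCut A P Q)
    (hD : Δ.NoThru A B C) {g h : Set Pt} {P Q P' Q' x : Pt} (k : Δ.Cut A B C g P Q)
    (l : Δ.Cut A B C h P' Q') (hP : P' ∈ openSegment ℝ A P) (hv : Δ.IsVertex x)
    (hx : x ∈ openSegment ℝ A P) : x = P' := by
  obtain ⟨w, -, ⟨q, m⟩ | ⟨q, m⟩⟩ := t.cut_of_vertex hv (openSegment_trans hx k.hP)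
  · rcases openSegment_trichotomy l.hP m.hP with h1 | h1 | h1
    · exact h1.symm
    · exact (t.no_crossing_triple ih hA m l k h1 hP (t.cuts_cross hN l m h1)
        (t.cuts_cross hN k l hP)).elim
    · exact (t.no_crossing_triple ih hA l m k h1 hx (t.cuts_cross hN m l h1)
        (t.cuts_cross hN k m hx)).elim
  · exact absurd m.Qg (hD _ _ _ _ _ _ k m.hg hx m.Pg m.hQ)

lemma eq_of_vertex_cut (t : Δ.IsTri a b c A B C) {g h : Set Pt} {P Q P' Q' y z : Pt}
    (k : Δ.Cut A B C g P Q) (l : Δ.Cut A B C h P' Q') (hPP : P' ∈ openSegment ℝ A P)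
    (hQ : Q ∈ openSegment ℝ A Q')
    (h1 : ∀ x ∈ openSegment ℝ A P, Δ.IsVertex x → x = P')
    (h2 : ∀ x ∈ openSegment ℝ A Q', Δ.IsVertex x → x = Q) (hyg : y ∈ g) (hyh : y ∈ h)
    (hz : z ∈ openSegment ℝ P Q) (hv : Δ.IsVertex z) : z = y := by
  have t₁ := k.tri t
  obtain ⟨m, hmg, ⟨x, n⟩ | ⟨x, n⟩⟩ := t₁.rot.cut_of_vertex hv hz
  · obtain rfl := h1 x (mem_openSegment_comm.mp n.hQ) (n.isVertex_right t₁.rot)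
    have hmc := (t₁.rot.ne_of_sep (n.sepB t₁.rot)).2.1
    have := (no_three t.hc l.hg n.hg (t.mem_c l.hP) l.Pg n.Qg (l.ne_c t).symm).resolve_left hmc
    subst this
    exact Sbar_unique k.hg n.hg hmg.symm (t₁.mem_a hz) hyg n.Pg hyh
  · have hx := mem_openSegment_comm.mp n.hQ
    obtain rfl := h2 x (openSegment_trans hx hQ) (n.isVertex_right t₁.rot.swapAB)
    exact absurd rfl (ne_right_of_mem_openSegment hx t₁.hAC)

/-- If `A` is internally blocked and the side `AB` is proper, no two cuts at `A` cross. -/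
lemma no_crossing_pair (hS : Δ.Strong) (t : Δ.IsTri a b c A B C)
    (hc : ∀ i, c ≠ Δ.edge i) {g h : Set Pt} {P Q P' Q' : Pt}
    (k : Δ.Cut A B C g P Q) (l : Δ.Cut A B C h P' Q') (hP : P' ∈ openSegment ℝ A P)
    (hQ : Q ∈ openSegment ℝ A Q') (h1 : ∀ x ∈ openSegment ℝ A P, Δ.IsVertex x → x = P')
    (h2 : ∀ x ∈ openSegment ℝ A Q', Δ.IsVertex x → x = Q) : False := by
  obtain ⟨y, hyPQ, hyPQ', hyg, hyh⟩ := k.crossing l t hP hQ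
  have t₁ := k.tri t
  have t₂ := l.tri t
  have hgh : g ≠ h := by
    rintro rfl
    exact ne_right_of_mem_openSegment hP t₁.hAB
      (Sbar_unique l.hg t.hc (l.ne_c t) l.Pg k.Pg (t.mem_c l.hP) (t.mem_c k.hP))
  have hyP' : y ≠ P' := ne_left_of_mem_openSegment hyPQ' t₂.hBC
  have mPy : Δ.MinimalSeg P y := fun z hz hv =>
    ne_right_of_mem_openSegment hz (ne_left_of_mem_openSegment hyPQ t₁.hBC).symm
      (t.eq_of_vertex_cut k l hP hQ h1 h2 hyg hyh (openSegment_trans hz hyPQ) hv)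
  have mPy' : Δ.MinimalSeg P' y := fun z hz hv =>
    ne_right_of_mem_openSegment hz hyP'.symm
      (t.swap.eq_of_vertex_cut l.swap k.swap hQ hP h2 h1 hyh hyg
        (mem_openSegment_comm.mp (openSegment_trans hz hyPQ')) hv)
  have mPP : Δ.MinimalSeg P' P := fun z hz hv =>
    ne_left_of_mem_openSegment hz (ne_right_of_mem_openSegment hP t₁.hAB)
      (h1 z (mem_openSegment_comm.mp (openSegment_trans (mem_openSegment_comm.mp hz)
        (mem_openSegment_comm.mp hP))) hv)
  have mPA : Δ.MinimalSeg P' A := fun z hz hv =>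
    ne_left_of_mem_openSegment hz t₂.hAB.symm
      (h1 z (openSegment_trans (mem_openSegment_comm.mp hz) hP) hv)
  obtain ⟨Z, hZh, hZb, hZ, -⟩ := hS.next_on_line
    (⟨k.hg, l.hg, t.hc, hgh, k.ne_c t, l.ne_c t, k.Pg, hyg, l.Pg, hyh, t.mem_c l.hP,
      t.mem_c k.hP⟩ : Δ.IsTri g h c P' P y)
    (not_bdry_of_proper t.hc hc t.Ac t.Bc t.hAB l.hP) mPP mPy' mPy t.hb t.hbc t.Ac t.Ab hP mPA
    k.Qg (t.mem_b k.hQ)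
  obtain rfl := Sbar_unique l.hg t.hb (l.swap.ne_c t.swap) hZh l.Qg hZb (t.mem_b l.hQ)
  have h3 := openSegment_shift hZ (mem_openSegment_comm.mp hyPQ')
  rw [openSegment_same] at h3
  exact hyP' h3

lemma exists_crossing_pair (t : Δ.IsTri a b c A B C) (hA : Δ.Blk A B C)
    (hN : ∀ g P Q, Δ.Cut A B C g P Q → Δ.NoCut A P Q) (hD : Δ.NoThru A B C)
    (hD' : Δ.NoThru A C B) {g : Set Pt} {P Q : Pt} (k : Δ.Cut A B C g P Q) :
    ∃ g P Q h P' Q', Δ.Cut A B C g P Q ∧ Δ.Cut A B C h P' Q' ∧ P' ∈ openSegment ℝ A P ∧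
      Q ∈ openSegment ℝ A Q' := by
  have t₁ := k.tri t
  obtain ⟨β, hβ, -, hn⟩ := k.blk.mpr hA
  obtain ⟨z, hz, hzβ⟩ := exists_cross (B_chord hβ) t₁.tB t₁.tC hn
  obtain ⟨l, -, ⟨x, n⟩ | ⟨x, n⟩⟩ :=
    t₁.rot.cut_of_vertex (isVertex_of_block k.hg hβ (t₁.mem_a hz) hzβ) hz
  · have hx := mem_openSegment_comm.mp n.hQ
    obtain ⟨y, m⟩ | ⟨y, m⟩ := t.pasch n.hg (t₁.rot.ne_of_sep (n.sepB t₁.rot)).2.1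
      (openSegment_trans hx k.hP) n.Qg
    · exact ⟨g, P, Q, l, x, y, k, m, hx, t.cuts_cross hN k m hx⟩
    · exact absurd m.Qg (hD _ _ _ _ _ _ k m.hg hx m.Pg m.hQ)
  · have hx := mem_openSegment_comm.mp n.hQ
    obtain ⟨y, m⟩ | ⟨y, m⟩ := t.swap.pasch n.hg
      (t₁.rot.swapAB.ne_of_sep (n.sepB t₁.rot.swapAB)).2.1 (openSegment_trans hx k.hQ) n.Qg
    · exact ⟨l, y, x, g, P, Q, m.swap, k, t.swap.cuts_cross
        (fun g P Q c => (hN g Q P c.swap).swap) k.swap m hx, hx⟩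
    · exact absurd m.Qg (hD' _ _ _ _ _ _ k.swap m.hg hx m.Pg m.hQ)

lemma noCut_of_blk (hS : Δ.Strong) (t : Δ.IsTri a b c A B C)
    (ih : Δ.ControlledBelow (Δ.size A B C)) (hA : Δ.Blk A B C)
    (hp : (∀ i, b ≠ Δ.edge i) ∨ ∀ i, c ≠ Δ.edge i) : Δ.NoCut A B C := by
  intro g P Q k
  have ih' : Δ.ControlledBelow (Δ.size A C B) := by rwa [← size_swap]
  have hN : ∀ g P Q, Δ.Cut A B C g P Q → Δ.NoCut A P Q := fun g P Q k =>
    (ih _ _ _ _ _ _ (k.tri t) (size_cut t k)).noCut (k.blk.mpr hA) hp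
  have hN' : ∀ g P Q, Δ.Cut A C B g P Q → Δ.NoCut A P Q := fun g P Q k =>
    (hN g Q P k.swap).swap
  have hD := t.noThru_of_blk hS ih hA
  have hD' := t.swap.noThru_of_blk hS ih' hA.symm
  obtain ⟨g, P, Q, h, P', Q', k, l, hP, hQ⟩ := t.exists_crossing_pair hA hN hD hD' k
  have h1 : ∀ x ∈ openSegment ℝ A P, Δ.IsVertex x → x = P' := fun x hx hv =>
    t.eq_of_vertex_crossing ih hA hN hD k l hP hv hx
  have h2 : ∀ x ∈ openSegment ℝ A Q', Δ.IsVertex x → x = Q := fun x hx hv =>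
    t.swap.eq_of_vertex_crossing ih' hA.symm hN' hD' l.swap k.swap hQ hv hx
  rcases hp with hp | hp
  · exact t.swap.no_crossing_pair hS hp l.swap k.swap hQ hP h2 h1
  · exact t.no_crossing_pair hS hp k l hP hQ h1 h2

end IsTri

lemma Strong.controlledBelow (hS : Δ.Strong) (n : ℕ) : Δ.ControlledBelow n := by
  induction n with
  | zero => exact fun _ _ _ _ _ _ _ h => absurd h (Nat.not_lt_zero _)
  | succ n ih =>
    intro a b c A B C t h
    have ih' : Δ.ControlledBelow (Δ.size A B C) := fun a b c A' B' C' t' h' =>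
      ih a b c A' B' C' t' (h'.trans_le (Nat.lt_succ_iff.mp h))
    exact ⟨t.noThru_of_blk hS ih', t.noCross_of_not_blk hS ih', t.noCut_of_blk hS ih'⟩

end TBA

/-! ### The main triangle -/

namespace TBA

variable {Δ : TBA}

lemma proper_of_mem_S {s : Set Pt} (hs : s ∈ Δ.S) (i : Fin 3) : s ≠ Δ.edge i := by
  obtain ⟨u, w, -, rfl, -, -, h⟩ := Δ.seg_wf s (Or.inl hs)
  have hm : midpoint ℝ u w ∈ openSegment ℝ u w := midpoint_mem_openSegment u w
  exact proper_of_not_bdry (openSegment_subset_segment _ _ _ hm) (h _ hm) i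

lemma ne_of_mem_edges {s : Set Pt} (hs : s ∈ Δ.S) {i j : Fin 3} (hij : i ≠ j) {x y : Pt}
    (hx : x ∈ s) (hi : y ∈ Δ.edge i) (hj : y ∈ Δ.edge j) : y ≠ x := by
  rintro rfl
  exact (no_three (Δ.edge_mem_Sbar i) (Δ.edge_mem_Sbar j) (Or.inl hs) hi hj hx
    (Δ.edge_injective.ne hij)).elim (proper_of_mem_S hs i) (proper_of_mem_S hs j)

variable (Δ) in
lemma x1_mem_edge {i : Fin 3} (hi : i ≠ 0) : Δ.x1 ∈ Δ.edge i := by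
  have h := left_mem_segment ℝ Δ.x1 Δ.x2
  have h' := right_mem_segment ℝ Δ.x3 Δ.x1
  rw [segment_x1_x2] at h
  rw [segment_x3_x1] at h'
  fin_cases i
  exacts [absurd rfl hi, h', h]

variable (Δ) in
lemma x2_mem_edge {i : Fin 3} (hi : i ≠ 1) : Δ.x2 ∈ Δ.edge i := by
  have h := left_mem_segment ℝ Δ.x2 Δ.x3
  have h' := right_mem_segment ℝ Δ.x1 Δ.x2
  rw [segment_x2_x3] at h
  rw [segment_x1_x2] at h'
  fin_cases i
  exacts [h, absurd rfl hi, h']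

variable (Δ) in
lemma x3_mem_edge {i : Fin 3} (hi : i ≠ 2) : Δ.x3 ∈ Δ.edge i := by
  have h := left_mem_segment ℝ Δ.x3 Δ.x1
  have h' := right_mem_segment ℝ Δ.x2 Δ.x3
  rw [segment_x3_x1] at h
  rw [segment_x2_x3] at h'
  fin_cases i
  exacts [h', h, absurd rfl hi]

variable (Δ) in
lemma isTri_main : Δ.IsTri (Δ.edge 0) (Δ.edge 2) (Δ.edge 1) Δ.x1 Δ.x3 Δ.x2 where
  ha := Δ.edge_mem_Sbar 0
  hb := Δ.edge_mem_Sbar 2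
  hc := Δ.edge_mem_Sbar 1
  hab := Δ.edge_injective.ne (by decide)
  hac := Δ.edge_injective.ne (by decide)
  hbc := Δ.edge_injective.ne (by decide)
  Ba := Δ.x3_mem_edge (by decide)
  Ca := Δ.x2_mem_edge (by decide)
  Ab := Δ.x1_mem_edge (by decide)
  Cb := Δ.x2_mem_edge (by decide)
  Ac := Δ.x1_mem_edge (by decide)
  Bc := Δ.x3_mem_edge (by decide)

lemma segment_pos (f : Pt →ᵃ[ℝ] ℝ) {x y z : Pt} (hz : z ∈ segment ℝ x y) (h : 0 < f x * f y) :
    f z ≠ 0 := by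
  rw [← insert_endpoints_openSegment] at hz
  rcases hz with rfl | rfl | hz
  · exact left_ne_zero_of_mul h.ne'
  · exact right_ne_zero_of_mul h.ne'
  · exact right_ne_zero_of_mul (mul_pos_between f hz h).ne'

lemma blk_main {β : Set Pt} (hβ : β ∈ Δ.B) (h : Δ.x1 ∈ β) : Δ.Blk Δ.x1 Δ.x3 Δ.x2 := by
  have t := Δ.isTri_main
  have h0 := fn_zero (B_chord hβ) h
  have h3 : Δ.fn β Δ.x3 ≠ 0 := fn_ne (B_chord hβ) t.tB fun h3 =>
    t.hAB (block_unique_point t.hc hβ t.Ac t.Bc h h3)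
  have h2 : Δ.fn β Δ.x2 ≠ 0 := fn_ne (B_chord hβ) t.tC fun h2 =>
    t.hAC (block_unique_point t.hb hβ t.Ab t.Cb h h2)
  refine ⟨β, hβ, h, lt_of_not_ge fun hn => ?_⟩
  have hpos := hn.lt_of_ne (mul_ne_zero h3 h2).symm
  obtain ⟨z, hz, hzx⟩ : ∃ z ∈ β, z ≠ Δ.x1 := by
    obtain ⟨u, w, huw, rfl, -⟩ := Δ.seg_wf β (Or.inr hβ)
    by_cases hu : u = Δ.x1
    · exact ⟨w, right_mem_segment _ _ _, fun hw => huw (hu.trans hw.symm)⟩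
    · exact ⟨u, left_mem_segment _ _ _, hu⟩
  have hzT := chord_tri (B_chord hβ) hz
  rw [tri, convexHull_insert (by simp), convexHull_pair, convexJoin_singleton_left] at hzT
  simp only [mem_iUnion] at hzT
  obtain ⟨w, hw, hzw⟩ := hzT
  have hw0 := segment_pos (Δ.fn β) (segment_symm ℝ Δ.x2 Δ.x3 ▸ hw) hpos
  have hz0 := fn_zero (B_chord hβ) hz
  have hwz : w ≠ z := by rintro rfl; exact hw0 hz0
  exact left_ne_zero_of_mul (mul_pos_of_zero_left (Δ.fn β)
    (mem_openSegment_of_ne_left_right hzx.symm hwz hzw) h0 hw0).ne' hz0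

end TBA

/-- Proposition 9: in a strong triangle blocking arrangement with blocking segments through
`x₁` and `x₂`, initial segments `a₁a₂` and `b₁b₂` with `a₁ ∈ x₁x₂`, `b₂ ∈ x₂x₃` and
`a₂, b₁ ∈ x₁x₃` are disjoint. -/
theorem TBA.forbidden_structure_2 (Δ : TBA) (hstrong : Δ.Strong)
    (hx1 : ∃ b ∈ Δ.B, Δ.x1 ∈ b) (hx2 : ∃ b ∈ Δ.B, Δ.x2 ∈ b)
    (a₁ a₂ b₁ b₂ : Pt)
    (ha₁ : a₁ ∈ segment ℝ Δ.x1 Δ.x2) (hb₂ : b₂ ∈ segment ℝ Δ.x2 Δ.x3)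
    (ha₂ : a₂ ∈ segment ℝ Δ.x1 Δ.x3) (hb₁ : b₁ ∈ segment ℝ Δ.x1 Δ.x3)
    (hA : segment ℝ a₁ a₂ ∈ Δ.S) (hB : segment ℝ b₁ b₂ ∈ Δ.S) :
    Disjoint (segment ℝ a₁ a₂) (segment ℝ b₁ b₂) := by
  have t := Δ.isTri_main
  obtain ⟨β, hβ, hxβ⟩ := hx1
  have hD := t.noThru_of_blk hstrong (hstrong.controlledBelow _) (blk_main hβ hxβ)
  have l₁ := left_mem_segment ℝ a₁ a₂
  have r₁ := right_mem_segment ℝ a₁ a₂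
  have l₂ := left_mem_segment ℝ b₁ b₂
  have r₂ := right_mem_segment ℝ b₁ b₂
  set g := segment ℝ a₁ a₂
  have oa₁ : a₁ ∈ openSegment ℝ Δ.x1 Δ.x2 := mem_openSegment_of_ne_left_right
    (TBA.ne_of_mem_edges hA (i := 1) (j := 2) (by decide) l₁ t.Ac t.Ab)
    (TBA.ne_of_mem_edges hA (i := 0) (j := 2) (by decide) l₁ t.Ca t.Cb) ha₁
  have oa₂ : a₂ ∈ openSegment ℝ Δ.x1 Δ.x3 := mem_openSegment_of_ne_left_right
    (TBA.ne_of_mem_edges hA (i := 1) (j := 2) (by decide) r₁ t.Ac t.Ab)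
    (TBA.ne_of_mem_edges hA (i := 0) (j := 1) (by decide) r₁ t.Ba t.Bc) ha₂
  have ob₁ : b₁ ∈ openSegment ℝ Δ.x1 Δ.x3 := mem_openSegment_of_ne_left_right
    (TBA.ne_of_mem_edges hB (i := 1) (j := 2) (by decide) l₂ t.Ac t.Ab)
    (TBA.ne_of_mem_edges hB (i := 0) (j := 1) (by decide) l₂ t.Ba t.Bc) hb₁
  have ob₂ : b₂ ∈ openSegment ℝ Δ.x3 Δ.x2 := mem_openSegment_comm.mp
    (mem_openSegment_of_ne_left_right
      (TBA.ne_of_mem_edges hB (i := 0) (j := 2) (by decide) r₂ t.Ca t.Cb)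
      (TBA.ne_of_mem_edges hB (i := 0) (j := 1) (by decide) r₂ t.Ba t.Bc) hb₂)
  have k : Δ.Cut Δ.x1 Δ.x3 Δ.x2 g a₂ a₁ := ⟨Or.inl hA, r₁, l₁, oa₂, oa₁⟩
  have hg := TBA.Sbar_chord k.hg
  have hb₂g := opp_same (k.sepB t)
    (mul_pos_between (Δ.fn g) ob₂ (opp_opp (opp_comm (k.sepB t)) (k.sepC t)))
  rw [Set.disjoint_left]
  intro z hz hz'
  rcases openSegment_trichotomy oa₂ ob₁ with rfl | h | h
  · rcases TBA.no_three t.hc k.hg (Or.inl hB) (t.mem_c oa₂) k.Pg l₂ (k.ne_c t).symm with h | h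
    · exact TBA.proper_of_mem_S hB _ h
    · exact right_ne_zero_of_opp hb₂g (TBA.fn_zero hg (h ▸ r₂))
  · exact hD _ _ _ _ _ _ k (Or.inl hB) h l₂ ob₂ r₂
  · have hb₁g := mul_neg_of_zero_between (Δ.fn g) h (TBA.fn_zero hg r₁)
      (left_ne_zero_of_opp hb₂g)
    exact TBA.segment_pos (Δ.fn g) hz' (opp_opp (opp_comm hb₁g) hb₂g) (TBA.fn_zero hg hz)
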